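/- arXiv:2301.09970 — 7 statements merged into one kernel-verified Lean document; each statement's English description precedes it below -/
import Mathlib

section
/- Let D be an almost Dedekind domain. Then: (a) Crit^1(D) = Crit(D), i.e., a maximal ideal is 1-critical if and only if it is critical; (b) the family {Crit^n(D) : n ∈ ℕ, n ≥ 1} is a descending chain (Crit^{n+1}(D) ⊆ Crit^n(D)) of closed subsets of Max(D) with respect to the constructible topology; (c) Crit^ω(D) = ⋂_{n ∈ ℕ} Crit^n(D), and in particular Crit^ω(D) is closed in Max(D). -/
/-!
Common definitions: almost Dedekind domains, ideal functions, critical ideals,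
the constructible topology on the maximal spectrum.
-/

open scoped Classical Topology

namespace ADPaper

variable (R : Type*) [CommRing R]

/-- The normalized valuation `v_M(x)` of an element `x` of `R` in the localization at the
maximal ideal `M`: the largest `n` such that the image of `x` lies in the `n`-th power of the
maximal ideal of `R_M` (a junk value if no largest such `n` exists). -/
noncomputable def elemVal (M : MaximalSpectrum R) (x : R) : ℕ :=
  sSup {n : ℕ | algebraMap R (Localization.AtPrime M.asIdeal) x ∈
    IsLocalRing.maximalIdeal (Localization.AtPrime M.asIdeal) ^ n}

/-- The ideal function `ν_I(M) = v_M(I) = min { v_M(x) : x ∈ I, x ≠ 0 }`. -/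
noncomputable def nu (I : Ideal R) (M : MaximalSpectrum R) : ℕ :=
  sInf (elemVal R M '' {x | x ∈ I ∧ x ≠ 0})

/-- `R` is an almost Dedekind domain: the localization at every maximal ideal is a
discrete valuation ring. (The requirement that `R` is not a field is stated separately
where needed.) -/
def AlmostDedekind [IsDomain R] : Prop :=
  ∀ M : MaximalSpectrum R, IsDiscreteValuationRing (Localization.AtPrime M.asIdeal)

/-- An ideal `M` of a commutative ring is critical if it is maximal and contains no nonzero
finitely generated radical ideal. -/
def IsCritical (M : Ideal R) : Prop :=
  M.IsMaximal ∧ ∀ J : Ideal R, J ≠ ⊥ → J.FG → J.IsRadical → ¬ J ≤ M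

/-- `Crit R`: the set of critical maximal ideals, i.e. maximal ideals containing no
nonzero finitely generated radical ideal. -/
def Crit : Set (MaximalSpectrum R) :=
  {M | ∀ J : Ideal R, J ≠ ⊥ → J.FG → J.IsRadical → ¬ J ≤ M.asIdeal}

/-- `CritN R n`: the set of `n`-critical maximal ideals, i.e. maximal ideals containing no
nonzero finitely generated ideal whose ideal function is bounded by `n`. -/
def CritN (n : ℕ) : Set (MaximalSpectrum R) :=
  {M | ∀ J : Ideal R, J ≠ ⊥ → J.FG → (∀ N, nu R J N ≤ n) → ¬ J ≤ M.asIdeal}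

/-- `CritOmega R`: the set of `ω`-critical maximal ideals, i.e. maximal ideals containing no
nonzero finitely generated ideal whose ideal function is bounded. -/
def CritOmega : Set (MaximalSpectrum R) :=
  {M | ∀ J : Ideal R, J ≠ ⊥ → J.FG → (∃ n : ℕ, ∀ N, nu R J N ≤ n) → ¬ J ≤ M.asIdeal}

/-- The constructible topology on the maximal spectrum: generated by the sets
`V(J) = {M | J ≤ M}` and their complements, for `J` finitely generated. -/
def constrTop : TopologicalSpace (MaximalSpectrum R) :=
  TopologicalSpace.generateFrom
    {S | ∃ J : Ideal R, J.FG ∧ (S = {M | J ≤ M.asIdeal} ∨ S = {M | ¬ J ≤ M.asIdeal})}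

variable [IsDomain R]

/-- The localization `R_M` regarded as a subalgebra of the fraction field. -/
noncomputable def locSubalgebra (M : MaximalSpectrum R) : Subalgebra R (FractionRing R) :=
  Localization.subalgebra (FractionRing R) M.asIdeal.primeCompl
    (fun _s hs => mem_nonZeroDivisors_of_ne_zero fun h => hs (h ▸ M.asIdeal.zero_mem))

/-- The overring `⋂ {R_M : M ∈ X}` of `R` inside the fraction field (equal to the whole
fraction field when `X = ∅`). -/
noncomputable def interLoc (X : Set (MaximalSpectrum R)) : Subalgebra R (FractionRing R) :=
  ⨅ M ∈ X, locSubalgebra R M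

/-- The valuation `v_M` extended to the fraction field: `v_M(a/s) = v_M(a) - v_M(s)`. -/
noncomputable def elemValK (M : MaximalSpectrum R) (x : FractionRing R) : ℤ :=
  (elemVal R M (IsLocalization.sec (nonZeroDivisors R) x).1 : ℤ) -
    (elemVal R M ((IsLocalization.sec (nonZeroDivisors R) x).2 : R) : ℤ)

/-- The ideal function of a fractional ideal. -/
noncomputable def nuK (I : FractionalIdeal (nonZeroDivisors R) (FractionRing R))
    (M : MaximalSpectrum R) : ℤ :=
  sInf (elemValK R M '' {x | x ∈ I ∧ x ≠ 0})

end ADPaper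

namespace ADPaper

/-- In a discrete valuation ring, a nonzero ideal is radical iff it is not contained in the
square of the maximal ideal. -/
theorem isRadical_iff_not_le_maximalIdeal_sq {A : Type*} [CommRing A] [IsDomain A]
    [IsDiscreteValuationRing A] {I : Ideal A} (hI : I ≠ ⊥) :
    I.IsRadical ↔ ¬ I ≤ IsLocalRing.maximalIdeal A ^ 2 := by
  obtain ⟨ϖ, hϖ⟩ := IsDiscreteValuationRing.exists_irreducible A
  obtain ⟨k, rfl⟩ := IsDiscreteValuationRing.ideal_eq_span_pow_irreducible hI hϖ
  rw [hϖ.maximalIdeal_eq, Ideal.span_singleton_pow, Ideal.span_singleton_le_span_singleton,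
    pow_dvd_pow_iff hϖ.ne_zero hϖ.not_isUnit]
  constructor
  · intro h hk
    have h1 : ϖ ∈ Ideal.span {ϖ ^ k} := h ⟨k, Ideal.mem_span_singleton_self _⟩
    rw [Ideal.mem_span_singleton] at h1
    have h2 : ϖ ^ k ∣ ϖ ^ 1 := by simpa using h1
    rw [pow_dvd_pow_iff hϖ.ne_zero hϖ.not_isUnit] at h2
    omega
  · intro hk
    obtain rfl | rfl : k = 0 ∨ k = 1 := by omega
    · simp [Ideal.IsRadical]
    · rw [pow_one, ← hϖ.maximalIdeal_eq]
      exact (IsLocalRing.maximalIdeal.isMaximal A).isPrime.isRadical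

variable {R : Type*} [CommRing R] [IsDomain R]

theorem elemVal_le_iff (hAD : AlmostDedekind R) (M : MaximalSpectrum R) {x : R} (hx : x ≠ 0)
    (n : ℕ) : elemVal R M x ≤ n ↔ algebraMap R (Localization.AtPrime M.asIdeal) x ∉
      IsLocalRing.maximalIdeal (Localization.AtPrime M.asIdeal) ^ (n + 1) := by
  have := hAD M
  have hx' : algebraMap R (Localization.AtPrime M.asIdeal) x ≠ 0 := by
    simpa using (FaithfulSMul.algebraMap_injective R (Localization.AtPrime M.asIdeal)).ne hx
  obtain ⟨k, hk⟩ : ∃ k, algebraMap R (Localization.AtPrime M.asIdeal) x ∉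
      IsLocalRing.maximalIdeal (Localization.AtPrime M.asIdeal) ^ k := by
    by_contra! h
    have h' := Ideal.iInf_pow_eq_bot_of_isDomain
      (IsLocalRing.maximalIdeal (Localization.AtPrime M.asIdeal))
      (IsLocalRing.maximalIdeal.isMaximal _).ne_top
    exact hx' ((Submodule.mem_bot _).1 (h' ▸ Ideal.mem_iInf.2 h))
  have hbdd : BddAbove {n : ℕ | algebraMap R (Localization.AtPrime M.asIdeal) x ∈
      IsLocalRing.maximalIdeal (Localization.AtPrime M.asIdeal) ^ n} :=
    ⟨k, fun m hm => le_of_not_ge fun h => hk (Ideal.pow_le_pow_right h hm)⟩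
  constructor
  · intro h hmem
    have := le_csSup hbdd (Set.mem_ofPred.2 hmem)
    unfold elemVal at h
    omega
  · intro h
    exact csSup_le ⟨0, by simp⟩ fun m hm => le_of_not_gt fun hlt =>
      h (Ideal.pow_le_pow_right hlt hm)

theorem nu_le_iff (hAD : AlmostDedekind R) (M : MaximalSpectrum R) {J : Ideal R} (hJ : J ≠ ⊥)
    (n : ℕ) : nu R J M ≤ n ↔ ¬ J.map (algebraMap R (Localization.AtPrime M.asIdeal)) ≤
      IsLocalRing.maximalIdeal (Localization.AtPrime M.asIdeal) ^ (n + 1) := by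
  obtain ⟨y, hyJ, hy⟩ := Submodule.exists_mem_ne_zero_of_ne_bot hJ
  rw [Ideal.map_le_iff_le_comap]
  constructor
  · intro h hle
    obtain ⟨x, ⟨hxJ, hx⟩, hxv⟩ := Nat.sInf_mem
      (⟨_, y, ⟨hyJ, hy⟩, rfl⟩ : (elemVal R M '' {x | x ∈ J ∧ x ≠ 0}).Nonempty)
    exact (elemVal_le_iff hAD M hx n).1 (hxv.trans_le h) (hle hxJ)
  · intro h
    obtain ⟨x, hxJ, hx⟩ := SetLike.not_le_iff_exists.1 h
    have hx0 : x ≠ 0 := fun h0 => hx (by simp [h0])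
    have hle : nu R J M ≤ elemVal R M x := Nat.sInf_le ⟨x, ⟨hxJ, hx0⟩, rfl⟩
    exact hle.trans ((elemVal_le_iff hAD M hx0 n).2 hx)

/-- An ideal is radical iff its extension to the localization at each maximal ideal is. -/
theorem isRadical_iff_forall_localization {S : Type*} [CommRing S] (J : Ideal S) :
    J.IsRadical ↔ ∀ M : MaximalSpectrum S,
      (J.map (algebraMap S (Localization.AtPrime M.asIdeal))).IsRadical := by
  constructor
  · intro h M
    rw [← Ideal.radical_eq_iff, ← IsLocalization.map_radical M.asIdeal.primeCompl, h.radical]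
  · intro h
    refine Ideal.le_of_localization_maximal fun P hP => ?_
    rw [IsLocalization.map_radical P.primeCompl]
    exact (h ⟨P, hP⟩).radical.le

/-- A nonzero ideal of an almost Dedekind domain is radical iff it is `1`-bounded. -/
theorem isRadical_iff_nu_le_one (hAD : AlmostDedekind R) {J : Ideal R} (hJ : J ≠ ⊥) :
    J.IsRadical ↔ ∀ M, nu R J M ≤ 1 := by
  rw [isRadical_iff_forall_localization]
  refine forall_congr' fun M => ?_
  have := hAD M
  rw [nu_le_iff hAD M hJ, isRadical_iff_not_le_maximalIdeal_sq]
  rwa [Ne, Ideal.map_eq_bot_iff_of_injective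
    (FaithfulSMul.algebraMap_injective R (Localization.AtPrime M.asIdeal))]

theorem isClosed_critN (S : Type*) [CommRing S] (n : ℕ) : IsClosed[constrTop S] (CritN S n) := by
  let _ := constrTop S
  have h : CritN S n = ⋂ (J : Ideal S) (_ : J ≠ ⊥) (_ : J.FG) (_ : ∀ N, nu S J N ≤ n),
      {M | ¬ J ≤ M.asIdeal} := by
    ext M
    simp [CritN]
  rw [h]
  refine isClosed_iInter fun J => isClosed_iInter fun _ => isClosed_iInter fun hJ =>
    isClosed_iInter fun _ => ⟨TopologicalSpace.isOpen_generateFrom_of_mem ⟨J, hJ, Or.inl ?_⟩⟩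
  ext M
  simp

theorem critOmega_eq_iInter (S : Type*) [CommRing S] : CritOmega S = ⋂ n : ℕ, CritN S n := by
  ext M
  simp only [CritOmega, CritN, Set.mem_iInter, Set.mem_ofPred_eq]
  exact ⟨fun h n J h0 hJ hn => h J h0 hJ ⟨n, hn⟩, fun h J h0 hJ ⟨n, hn⟩ => h n J h0 hJ hn⟩

end ADPaper

namespace ADPaper

/-- Let `D` be an almost Dedekind domain. Then (a) `Crit¹(D) = Crit(D)`;
(b) the family `{Critⁿ(D) : n ≥ 1}` is a descending chain of closed subsets of `Max(D)`
with the constructible topology; (c) `Critʷ(D) = ⋂ₙ Critⁿ(D)`, and `Critʷ(D)` is closed. -/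
theorem statement0 (R : Type*) [CommRing R] [IsDomain R] (hR : ¬ IsField R)
    (hAD : AlmostDedekind R) :
    CritN R 1 = Crit R ∧
    (∀ n : ℕ, 1 ≤ n → CritN R (n + 1) ⊆ CritN R n) ∧
    (∀ n : ℕ, 1 ≤ n → IsClosed[constrTop R] (CritN R n)) ∧
    CritOmega R = (⋂ n : ℕ, CritN R n) ∧
    IsClosed[constrTop R] (CritOmega R) := by
  refine ⟨?_, fun n _ M hM J h0 hJ hn => hM J h0 hJ fun N => (hn N).trans n.le_succ,
    fun n _ => isClosed_critN R n, critOmega_eq_iInter R, ?_⟩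
  · ext M
    exact forall_congr' fun J => forall_congr' fun h0 => forall_congr' fun _ =>
      imp_congr_left (isRadical_iff_nu_le_one hAD h0).symm
  · rw [critOmega_eq_iInter]
    let _ := constrTop R
    exact isClosed_iInter fun n => isClosed_critN R n

end ADPaper
end

section
/- Let D be an almost Dedekind domain and let I be a nonzero proper ideal of D. If V(I) ∩ Crit^ω(D) = ∅ (i.e., no ω-critical maximal ideal contains I), then I is bounded. Moreover, if I is finitely generated, then I is bounded if and only if V(I) ∩ Crit^ω(D) = ∅. -/
/-!
Common definitions: almost Dedekind domains, ideal functions, critical ideals,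
the constructible topology on the maximal spectrum.
-/

open scoped Classical Topology

namespace ADPaper

/-- If every prime over `I` contains a member of a multiplicatively closed family of finitely
generated ideals, then so does `I`. -/
theorem exists_mem_le_of_forall_isPrime {R : Type*} [CommRing R] {S : Set (Ideal R)}
    (htop : ⊤ ∈ S) (hmul : ∀ J ∈ S, ∀ K ∈ S, J * K ∈ S) (hfg : ∀ J ∈ S, J.FG) {I : Ideal R}
    (hprime : ∀ P : Ideal R, P.IsPrime → I ≤ P → ∃ J ∈ S, J ≤ P) : ∃ J ∈ S, J ≤ I := by
  have hOka : Ideal.IsOka fun K : Ideal R => ∃ J ∈ S, J ≤ K := by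
    refine ⟨⟨⊤, htop, le_rfl⟩, ?_⟩
    rintro K a ⟨J₁, hJ₁, h₁⟩ ⟨J₂, hJ₂, h₂⟩
    refine ⟨J₁ * J₂, hmul _ hJ₁ _ hJ₂, (Ideal.mul_mono h₁ h₂).trans ?_⟩
    rw [Ideal.sup_mul, sup_le_iff]
    refine ⟨Ideal.mul_le_left, Ideal.span_singleton_mul_le_iff.2 fun z hz => ?_⟩
    rw [mul_comm]
    exact Ideal.mem_colon_span_singleton.1 hz
  by_contra hI
  obtain ⟨P, hIP, hP⟩ :=
    zorn_le_nonempty₀ {K : Ideal R | ¬ ∃ J ∈ S, J ≤ K} (fun C hC hchain K hK => by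
      refine ⟨sSup C, ?_, fun _ => le_sSup⟩
      rintro ⟨J, hJ, hJC⟩
      obtain ⟨L, hL, hJL⟩ := (CompleteLattice.isCompactElement_iff_le_of_directed_sSup_le _ J).1
        ((Submodule.fg_iff_compact J).1 (hfg J hJ)) C ⟨K, hK⟩ hchain.directedOn hJC
      exact hC hL ⟨J, hJ, hJL⟩) I hI
  exact hP.prop (hprime P (hOka.isPrime_of_maximal_not hP) hIP)

section

variable {R : Type*} [CommRing R]

theorem nu_le_elemVal {I : Ideal R} {x : R} (hxI : x ∈ I) (hx : x ≠ 0) (M : MaximalSpectrum R) :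
    nu R I M ≤ elemVal R M x :=
  Nat.sInf_le ⟨x, ⟨hxI, hx⟩, rfl⟩

theorem exists_elemVal_eq_nu {I : Ideal R} (hI : I ≠ ⊥) (M : MaximalSpectrum R) :
    ∃ x ∈ I, x ≠ 0 ∧ elemVal R M x = nu R I M := by
  obtain ⟨y, hyI, hy⟩ := Submodule.exists_mem_ne_zero_of_ne_bot hI
  obtain ⟨x, ⟨hxI, hx⟩, h⟩ := Nat.sInf_mem (s := elemVal R M '' {x | x ∈ I ∧ x ≠ 0})
    ⟨_, y, ⟨hyI, hy⟩, rfl⟩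
  exact ⟨x, hxI, hx, h⟩

theorem nu_anti {I J : Ideal R} (hJ : J ≠ ⊥) (hJI : J ≤ I) (M : MaximalSpectrum R) :
    nu R I M ≤ nu R J M := by
  obtain ⟨x, hxJ, hx, h⟩ := exists_elemVal_eq_nu hJ M
  exact h ▸ nu_le_elemVal (hJI hxJ) hx M

variable [IsDomain R]

theorem coe_elemVal (hAD : AlmostDedekind R) (M : MaximalSpectrum R) {x : R} (hx : x ≠ 0) :
    haveI := hAD M
    (elemVal R M x : ℕ∞) =
      IsDiscreteValuationRing.addVal _ (algebraMap R (Localization.AtPrime M.asIdeal) x) := by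
  have := hAD M
  obtain ⟨p, hp⟩ :=
    IsDiscreteValuationRing.exists_irreducible (Localization.AtPrime M.asIdeal)
  have hx' : algebraMap R (Localization.AtPrime M.asIdeal) x ≠ 0 := fun h =>
    hx (IsLocalization.injective _ M.asIdeal.primeCompl_le_nonZeroDivisors
      (h.trans (map_zero _).symm))
  obtain ⟨a, ha⟩ := ENat.ne_top_iff_exists.1
    (mt IsDiscreteValuationRing.addVal_eq_top_iff.1 hx')
  have hset : {n : ℕ | algebraMap R (Localization.AtPrime M.asIdeal) x ∈
      IsLocalRing.maximalIdeal (Localization.AtPrime M.asIdeal) ^ n} = Set.Iic a := by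
    ext n
    rw [Set.mem_ofPred_eq, hp.maximalIdeal_eq, Ideal.span_singleton_pow,
      Ideal.mem_span_singleton, ← IsDiscreteValuationRing.addVal_le_iff_dvd, hp.addVal_pow, ← ha,
      Set.mem_Iic, Nat.cast_le]
  rw [elemVal, hset, csSup_Iic, ha]

theorem elemVal_one (hAD : AlmostDedekind R) (M : MaximalSpectrum R) : elemVal R M 1 = 0 := by
  have := hAD M
  have h := coe_elemVal hAD M (one_ne_zero : (1 : R) ≠ 0)
  rw [map_one, IsDiscreteValuationRing.addVal_one] at h
  exact_mod_cast h

theorem elemVal_mul (hAD : AlmostDedekind R) (M : MaximalSpectrum R) {x y : R} (hx : x ≠ 0)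
    (hy : y ≠ 0) : elemVal R M (x * y) = elemVal R M x + elemVal R M y := by
  have := hAD M
  have h := coe_elemVal hAD M (mul_ne_zero hx hy)
  rw [map_mul, IsDiscreteValuationRing.addVal_mul, ← coe_elemVal hAD M hx,
    ← coe_elemVal hAD M hy] at h
  exact_mod_cast h

theorem nu_mul_le (hAD : AlmostDedekind R) {I J : Ideal R} (hI : I ≠ ⊥) (hJ : J ≠ ⊥)
    (M : MaximalSpectrum R) : nu R (I * J) M ≤ nu R I M + nu R J M := by
  obtain ⟨x, hxI, hx, h⟩ := exists_elemVal_eq_nu hI M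
  obtain ⟨y, hyJ, hy, h'⟩ := exists_elemVal_eq_nu hJ M
  rw [← h, ← h', ← elemVal_mul hAD M hx hy]
  exact nu_le_elemVal (Ideal.mul_mem_mul hxI hyJ) (mul_ne_zero hx hy) M

theorem AlmostDedekind.isMaximal_of_isPrime (hAD : AlmostDedekind R) {P : Ideal R}
    (hP : P.IsPrime) (hP0 : P ≠ ⊥) : P.IsMaximal := by
  obtain ⟨M, hM, hPM⟩ := P.exists_le_maximal hP.ne_top
  let A := Localization.AtPrime M
  have : IsDiscreteValuationRing A := hAD ⟨M, hM⟩
  have hd : Disjoint (M.primeCompl : Set R) P :=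
    Set.disjoint_left.2 fun _ hx hxP => hx (hPM hxP)
  have hprime := IsLocalization.isPrime_of_isPrime_disjoint M.primeCompl A P hP hd
  have hne : P.map (algebraMap R A) ≠ ⊥ := fun h => hP0
    ((Ideal.map_eq_bot_iff_of_injective
      (IsLocalization.injective A M.primeCompl_le_nonZeroDivisors)).1 h)
  have hmax : P.map (algebraMap R A) = IsLocalRing.maximalIdeal A :=
    IsLocalRing.eq_maximalIdeal (hprime.isMaximal hne)
  have h := IsLocalization.under_map_of_isPrime_disjoint M.primeCompl A hP hd
  rw [hmax, Localization.AtPrime.under_maximalIdeal] at h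
  exact h ▸ hM

end

/-- Let `D` be an almost Dedekind domain and `I` a nonzero proper ideal.
If `V(I) ∩ Critʷ(D) = ∅` then `I` is bounded; and if `I` is finitely generated, then `I` is
bounded if and only if `V(I) ∩ Critʷ(D) = ∅`. -/
theorem statement1 (R : Type*) [CommRing R] [IsDomain R] (hR : ¬ IsField R)
    (hAD : AlmostDedekind R) (I : Ideal R) (hI : I ≠ ⊥) (hItop : I ≠ ⊤) :
    ({M : MaximalSpectrum R | I ≤ M.asIdeal} ∩ CritOmega R = ∅ →
      ∃ n : ℕ, ∀ M, nu R I M ≤ n) ∧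
    (I.FG → ((∃ n : ℕ, ∀ M, nu R I M ≤ n) ↔
      {M : MaximalSpectrum R | I ≤ M.asIdeal} ∩ CritOmega R = ∅)) := by
  have hforward : {M : MaximalSpectrum R | I ≤ M.asIdeal} ∩ CritOmega R = ∅ →
      ∃ n : ℕ, ∀ M, nu R I M ≤ n := by
    intro h
    obtain ⟨J, ⟨hJ, -, n, hn⟩, hJI⟩ := exists_mem_le_of_forall_isPrime (I := I)
      (S := {J : Ideal R | J ≠ ⊥ ∧ J.FG ∧ ∃ n : ℕ, ∀ N, nu R J N ≤ n})
      ⟨top_ne_bot, Submodule.FG.of_finite, 0, fun N =>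
        (nu_le_elemVal Submodule.mem_top one_ne_zero N).trans (elemVal_one hAD N).le⟩
      (fun J ⟨hJ, hJfg, m, hm⟩ K ⟨hK, hKfg, n, hn⟩ => ⟨mul_ne_zero hJ hK, hJfg.mul hKfg, m + n,
        fun N => (nu_mul_le hAD hJ hK N).trans (add_le_add (hm N) (hn N))⟩)
      (fun J hJ => hJ.2.1)
      (fun P hP hIP => by
        have hmax := hAD.isMaximal_of_isPrime hP (ne_bot_of_le_ne_bot hI hIP)
        by_contra hcon
        refine Set.eq_empty_iff_forall_notMem.1 h ⟨P, hmax⟩ ⟨hIP, ?_⟩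
        exact fun J hJ hJfg hJb hJP => hcon ⟨J, ⟨hJ, hJfg, hJb⟩, hJP⟩)
    exact ⟨n, fun M => (nu_anti hJ hJI M).trans (hn M)⟩
  refine ⟨hforward, fun hfg => ⟨fun hb => ?_, hforward⟩⟩
  exact Set.eq_empty_iff_forall_notMem.2 fun M ⟨hM, hcrit⟩ => hcrit I hI hfg hb hM

end ADPaper
end

section
/- Let D be an almost Dedekind domain that is not a field. Then Crit(D) ≠ Max(D); that is, there exists a maximal ideal of D that contains a nonzero finitely generated radical ideal of D. -/
/-!
Common definitions: almost Dedekind domains, ideal functions, critical ideals,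
the constructible topology on the maximal spectrum.
-/

open scoped Classical Topology

namespace ADPaper

/-- In a discrete valuation ring, an ideal not contained in the square of the maximal ideal
contains the maximal ideal. -/
theorem maximalIdeal_le_of_not_le_sq {A : Type*} [CommRing A] [IsDomain A]
    [IsDiscreteValuationRing A] {I : Ideal A} (hI : ¬ I ≤ IsLocalRing.maximalIdeal A ^ 2) :
    IsLocalRing.maximalIdeal A ≤ I := by
  obtain ⟨a, haI, ha⟩ := SetLike.not_le_iff_exists.mp hI
  obtain ⟨p, hp⟩ := IsDiscreteValuationRing.exists_irreducible A
  have ha0 : a ≠ 0 := by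
    rintro rfl
    exact ha (zero_mem _)
  obtain ⟨n, u, rfl⟩ := IsDiscreteValuationRing.eq_unit_mul_pow_irreducible ha0 hp
  have hpm : p ∈ IsLocalRing.maximalIdeal A := (IsLocalRing.mem_maximalIdeal p).mpr hp.not_isUnit
  have hn : n ≤ 1 := by
    by_contra! hn
    exact ha (Ideal.mul_mem_left _ _ (Ideal.pow_le_pow_right hn (Ideal.pow_mem_pow hpm n)))
  rw [hp.maximalIdeal_eq, Ideal.span_singleton_le_iff_mem]
  have hpn : p ^ n ∈ I := (Ideal.unit_mul_mem_iff_mem I u.isUnit).mp haI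
  simpa using I.mem_of_dvd (pow_dvd_pow p hn) hpn

/-- In an almost Dedekind domain, an ideal contained in the square of no maximal ideal
is radical. -/
theorem AlmostDedekind.isRadical_of_not_le_sq {R : Type*} [CommRing R] [IsDomain R]
    (hAD : AlmostDedekind R) {I : Ideal R} (hI : ∀ M : MaximalSpectrum R, ¬ I ≤ M.asIdeal ^ 2) :
    I.IsRadical := by
  rintro x ⟨k, hx⟩
  refine Ideal.mem_of_localization_maximal fun M hM ↦ ?_
  by_cases hIM : I ≤ M
  · have := hAD ⟨M, hM⟩
    refine maximalIdeal_le_of_not_le_sq (fun hle ↦ hI ⟨M, hM⟩ ?_) ?_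
    · rw [← Localization.AtPrime.map_eq_maximalIdeal, ← Ideal.map_pow] at hle
      intro y hy
      obtain ⟨m, hm, hmy⟩ := (IsLocalization.algebraMap_mem_map_algebraMap_iff M.primeCompl
        (Localization.AtPrime M) (M ^ 2) y).mp (hle (Ideal.mem_map_of_mem _ hy))
      exact (Ideal.IsMaximal.mul_mem_pow _ hmy).resolve_left hm
    · rw [← Localization.AtPrime.map_eq_maximalIdeal]
      exact Ideal.mem_map_of_mem _ (hM.isPrime.mem_of_pow_mem k (hIM hx))
  · simp [IsLocalization.AtPrime.map_eq_top_of_not_le _ hIM]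

/-- A finitely generated ideal contained in the square of an ideal `M` is contained in the square
of a finitely generated subideal of `M`. -/
theorem exists_fg_le_sq {R : Type*} [CommRing R] {I M : Ideal R} (hI : I.FG) (h : I ≤ M ^ 2) :
    ∃ J : Ideal R, J.FG ∧ J ≤ M ∧ I ≤ J ^ 2 := by
  induction I, hI using Submodule.fg_induction with
  | singleton x =>
    simp only [Submodule.span_singleton_le_iff_mem] at h ⊢
    rw [pow_two] at h
    induction h using Submodule.mul_induction_on' with
    | mem_mul_mem a ha b hb =>
      refine ⟨Ideal.span {a, b}, Submodule.fg_span (by simp), ?_, ?_⟩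
      · simp [Ideal.span_le, Set.insert_subset_iff, ha, hb]
      · rw [pow_two]
        exact Ideal.mul_mem_mul (Ideal.subset_span (by simp)) (Ideal.subset_span (by simp))
    | add a _ b _ iha ihb =>
      obtain ⟨J, hJ, hJM, haJ⟩ := iha
      obtain ⟨K, hK, hKM, hbK⟩ := ihb
      exact ⟨J ⊔ K, Submodule.FG.sup hJ hK, sup_le hJM hKM,
        add_mem (Ideal.pow_right_mono le_sup_left 2 haJ)
          (Ideal.pow_right_mono le_sup_right 2 hbK)⟩
  | sup I₁ I₂ _ _ ih₁ ih₂ =>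
    obtain ⟨J, hJ, hJM, haJ⟩ := ih₁ (le_sup_left.trans h)
    obtain ⟨K, hK, hKM, hbK⟩ := ih₂ (le_sup_right.trans h)
    exact ⟨J ⊔ K, Submodule.FG.sup hJ hK, sup_le hJM hKM, sup_le
      (haJ.trans (Ideal.pow_right_mono le_sup_left 2))
      (hbK.trans (Ideal.pow_right_mono le_sup_right 2))⟩

/-- In an almost Dedekind domain, the powers of a maximal ideal have zero intersection. -/
theorem AlmostDedekind.eq_zero_of_forall_mem_pow {R : Type*} [CommRing R] [IsDomain R]
    (hAD : AlmostDedekind R) (M : MaximalSpectrum R) {x : R} (hx : ∀ n, x ∈ M.asIdeal ^ n) :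
    x = 0 := by
  have := hAD M
  have hmem : algebraMap R (Localization.AtPrime M.asIdeal) x ∈
      ⨅ n : ℕ, IsLocalRing.maximalIdeal (Localization.AtPrime M.asIdeal) ^ n := by
    simp only [Submodule.mem_iInf]
    intro n
    rw [← Localization.AtPrime.map_eq_maximalIdeal, ← Ideal.map_pow]
    exact Ideal.mem_map_of_mem _ (hx n)
  rw [Ideal.iInf_pow_eq_bot_of_isLocalRing _ Ideal.IsPrime.ne_top', Ideal.mem_bot] at hmem
  exact (IsLocalization.to_map_eq_zero_iff _ M.asIdeal.primeCompl_le_nonZeroDivisors).mp hmem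

/-- An almost Dedekind domain that is not a field has a proper nonzero finitely generated
radical ideal. -/
theorem AlmostDedekind.exists_fg_isRadical {R : Type*} [CommRing R] [IsDomain R]
    (hAD : AlmostDedekind R) (hR : ¬ IsField R) :
    ∃ J : Ideal R, J ≠ ⊥ ∧ J ≠ ⊤ ∧ J.FG ∧ J.IsRadical := by
  by_contra! hno
  obtain ⟨x, hx0, hxu⟩ := Ring.exists_not_isUnit_of_not_isField hR
  have step (I : {I : Ideal R // I ≠ ⊥ ∧ I ≠ ⊤ ∧ I.FG}) :
      ∃ J : {I : Ideal R // I ≠ ⊥ ∧ I ≠ ⊤ ∧ I.FG}, I.1 ≤ J.1 ^ 2 := by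
    obtain ⟨I, hbot, htop, hfg⟩ := I
    obtain ⟨M, hM⟩ : ∃ M : MaximalSpectrum R, I ≤ M.asIdeal ^ 2 := by
      by_contra! h
      exact hno I hbot htop hfg (hAD.isRadical_of_not_le_sq h)
    obtain ⟨J, hJ, hJM, hIJ⟩ := exists_fg_le_sq hfg hM
    refine ⟨⟨J, ?_, ?_, hJ⟩, hIJ⟩
    · rintro rfl
      exact hbot (by simpa using hIJ)
    · rintro rfl
      exact M.isMaximal.ne_top (top_le_iff.mp hJM)
  choose next hnext using step
  let chain (n : ℕ) := next^[n] ⟨Ideal.span {x}, by simpa, by simpa, Submodule.fg_span_singleton x⟩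
  have hchain (n : ℕ) : (chain n).1 ≤ (chain (n + 1)).1 ^ 2 := by
    simp only [chain, Function.iterate_succ_apply']
    exact hnext _
  have hmono : Monotone fun n ↦ (chain n).1 :=
    monotone_nat_of_le_succ fun n ↦ (hchain n).trans (Ideal.pow_le_self two_ne_zero)
  have hpow (n : ℕ) : x ∈ (chain n).1 ^ 2 ^ n := by
    induction n with
    | zero => simp [chain]
    | succ n ih =>
      rw [pow_succ', pow_mul]
      exact Ideal.pow_right_mono (hchain n) _ ih
  have hsup : ⨆ n, (chain n).1 ≠ ⊤ := by
    rw [Ne, Ideal.eq_top_iff_one, Submodule.mem_iSup_of_directed _ hmono.directed_le]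
    rintro ⟨n, hn⟩
    exact (chain n).2.2.1 ((Ideal.eq_top_iff_one _).mpr hn)
  obtain ⟨M, hM, hle⟩ := Ideal.exists_le_maximal _ hsup
  refine hx0 (hAD.eq_zero_of_forall_mem_pow ⟨M, hM⟩ fun n ↦ ?_)
  exact Ideal.pow_le_pow_right Nat.lt_two_pow_self.le
    (Ideal.pow_right_mono ((le_iSup _ n).trans hle) _ (hpow n))

/-- Let `D` be an almost Dedekind domain that is not a field. Then
`Crit(D) ≠ Max(D)`: there is a maximal ideal of `D` containing a nonzero finitely
generated radical ideal. -/
theorem statement10 (R : Type*) [CommRing R] [IsDomain R] (hR : ¬ IsField R)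
    (hAD : AlmostDedekind R) :
    Crit R ≠ Set.univ ∧
    ∃ (M : MaximalSpectrum R) (J : Ideal R), J ≠ ⊥ ∧ J.FG ∧ J.IsRadical ∧ J ≤ M.asIdeal := by
  obtain ⟨J, hbot, htop, hfg, hrad⟩ := hAD.exists_fg_isRadical hR
  obtain ⟨M, hM, hJM⟩ := J.exists_le_maximal htop
  refine ⟨fun h ↦ ?_, ⟨M, hM⟩, J, hbot, hfg, hrad, hJM⟩
  have hcrit : (⟨M, hM⟩ : MaximalSpectrum R) ∈ Crit R := h ▸ Set.mem_univ _
  exact hcrit J hbot hfg hrad hJM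

end ADPaper
end

section
/- Let D be an almost Dedekind domain that is not a field and is a Bézout domain (every finitely generated ideal is principal). Then D is not completely unbounded; that is, there exists a nonzero proper principal ideal of D that is bounded. -/
/-!
Common definitions: almost Dedekind domains, ideal functions, critical ideals,
the constructible topology on the maximal spectrum.
-/

open scoped Classical Topology

namespace ADPaper

/-- If `n ≥ 1` is at most `ν_{(c)}(M)`, then `c` lies in the `n`-th power of the maximal ideal
of the localization at `M`. -/
lemma mem_maximalIdeal_pow_of_le_nu {R : Type*} [CommRing R] {c : R} (hc : c ≠ 0)
    {M : MaximalSpectrum R} {n : ℕ} (hn : n ≠ 0) (h : n ≤ nu R (Ideal.span {c}) M) :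
    algebraMap R (Localization.AtPrime M.asIdeal) c ∈
      IsLocalRing.maximalIdeal (Localization.AtPrime M.asIdeal) ^ n := by
  have hle : n ≤ elemVal R M c :=
    h.trans (Nat.sInf_le ⟨c, ⟨Ideal.mem_span_singleton_self c, hc⟩, rfl⟩)
  unfold elemVal at hle
  set S := {n : ℕ | algebraMap R (Localization.AtPrime M.asIdeal) c ∈
    IsLocalRing.maximalIdeal (Localization.AtPrime M.asIdeal) ^ n} with hS
  have hbdd : BddAbove S := by
    by_contra hb
    rw [Nat.sSup_of_not_bddAbove hb] at hle
    omega
  have hmem : sSup S ∈ S := Nat.sSup_mem ⟨0, by simp [hS]⟩ hbdd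
  exact Ideal.pow_le_pow_right hle hmem

/-- In a Bézout domain, an element of the `n`-th power of a principal maximal ideal of a
localization is divisible by the `n`-th power of a nonunit. -/
lemma exists_pow_dvd_of_mem_maximalIdeal_pow {R : Type*} [CommRing R] [IsDomain R] [IsBezout R]
    (M : Ideal R) [M.IsMaximal]
    (hM : (IsLocalRing.maximalIdeal (Localization.AtPrime M)).IsPrincipal) {c : R} {n : ℕ}
    (hc : algebraMap R (Localization.AtPrime M) c ∈
      IsLocalRing.maximalIdeal (Localization.AtPrime M) ^ n) :
    ∃ d : R, ¬ IsUnit d ∧ d ^ n ∣ c := by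
  obtain ⟨ϖ, hϖ⟩ := hM.principal
  obtain ⟨⟨b, t⟩, hbt⟩ := IsLocalization.surj M.primeCompl ϖ
  have hspan : IsLocalRing.maximalIdeal (Localization.AtPrime M) =
      Ideal.span {algebraMap R (Localization.AtPrime M) b} := by
    rw [hϖ, ← hbt]
    exact (Ideal.span_singleton_mul_right_unit (IsLocalization.map_units _ t) ϖ).symm
  have hbM : b ∈ M := by
    rw [← IsLocalization.AtPrime.to_map_mem_maximal_iff (Localization.AtPrime M) M, hspan]
    exact Ideal.mem_span_singleton_self _
  rw [hspan, Ideal.span_singleton_pow, Ideal.mem_span_singleton] at hc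
  obtain ⟨q, hq⟩ := hc
  obtain ⟨⟨r, s⟩, hrs⟩ := IsLocalization.surj M.primeCompl q
  have hcs : c * s = b ^ n * r := by
    apply IsLocalization.injective (Localization.AtPrime M) M.primeCompl_le_nonZeroDivisors
    simp only [map_mul, map_pow] at hrs ⊢
    rw [hq, mul_assoc, hrs]
  obtain ⟨y, e, he, hye⟩ := (inferInstance : M.IsMaximal).exists_inv s.2
  have hdb := IsBezout.gcd_dvd_left b e
  have hde := IsBezout.gcd_dvd_right b e
  refine ⟨IsBezout.gcd b e, fun hu => ?_, ?_⟩
  · obtain ⟨x, z, hxz⟩ := IsBezout.gcd_eq_sum b e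
    exact (inferInstance : M.IsPrime).ne_top (Ideal.eq_top_of_isUnit_mem M
      (hxz ▸ M.add_mem (M.mul_mem_left x hbM) (M.mul_mem_left z he)) hu)
  · have hcop : IsCoprime e (s : R) := ⟨1, y, by rw [one_mul, add_comm]; exact hye⟩
    exact ((hcop.of_isCoprime_of_dvd_left hde).pow_left).dvd_of_dvd_mul_right
      (hcs ▸ (pow_dvd_pow_of_dvd hdb n).mul_right r)

/-- If `c (n + 1) ^ (n + 1)` divides `c n` for all `n` and no `c n` is a unit, then some maximal
ideal has all its powers containing `c 0`. -/
lemma exists_isMaximal_forall_mem_pow {R : Type*} [CommRing R] (c : ℕ → R)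
    (hu : ∀ n, ¬ IsUnit (c n)) (hdvd : ∀ n, c (n + 1) ^ (n + 1) ∣ c n) :
    ∃ M : Ideal R, M.IsMaximal ∧ ∀ n, c 0 ∈ M ^ n := by
  have hstep : ∀ n, c (n + 1) ∣ c n := fun n => (dvd_pow_self _ n.succ_ne_zero).trans (hdvd n)
  have hmono : Monotone fun n => Ideal.span {c n} :=
    monotone_nat_of_le_succ fun n => Ideal.span_singleton_le_span_singleton.2 (hstep n)
  have hne : (⨆ n, Ideal.span {c n}) ≠ ⊤ := by
    rw [Ideal.ne_top_iff_one, Submodule.mem_iSup_of_directed _ hmono.directed_le]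
    rintro ⟨n, hn⟩
    exact hu n (isUnit_of_dvd_one (Ideal.mem_span_singleton.1 hn))
  obtain ⟨M, hM, hle⟩ := Ideal.exists_le_maximal _ hne
  have hmem : ∀ n, c n ∈ M := fun n =>
    hle (Ideal.mem_iSup_of_mem n (Ideal.mem_span_singleton_self _))
  refine ⟨M, hM, fun n => Ideal.pow_le_pow_right n.le_succ ?_⟩
  have h0 : c n ∣ c 0 := Ideal.span_singleton_le_span_singleton.1 (hmono n.zero_le)
  exact Ideal.mem_of_dvd _ ((hdvd n).trans h0) (Ideal.pow_mem_pow (hmem (n + 1)) (n + 1))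

/-- Let `D` be a Bézout almost Dedekind domain that is not a field. Then
`D` is not completely unbounded: there is a nonzero proper principal ideal of `D` that is
bounded. -/
theorem statement11 (R : Type*) [CommRing R] [IsDomain R] [IsBezout R] (hR : ¬ IsField R)
    (hAD : AlmostDedekind R) :
    ∃ a : R, Ideal.span {a} ≠ ⊥ ∧ Ideal.span {a} ≠ ⊤ ∧
      ∃ n : ℕ, ∀ M, nu R (Ideal.span {a}) M ≤ n := by
  by_contra! hunb
  simp only [ne_eq, Ideal.span_singleton_eq_bot, Ideal.span_singleton_eq_top] at hunb
  have hroot : ∀ (n : ℕ) (c : {x : R // x ≠ 0 ∧ ¬ IsUnit x}),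
      ∃ d : {x : R // x ≠ 0 ∧ ¬ IsUnit x}, (d : R) ^ (n + 1) ∣ c := by
    rintro n ⟨c, hc0, hcu⟩
    obtain ⟨M, hM⟩ := hunb c hc0 hcu n
    have := hAD M
    have := M.isMaximal
    obtain ⟨d, hdu, hd⟩ := exists_pow_dvd_of_mem_maximalIdeal_pow M.asIdeal
      (IsPrincipalIdealRing.principal _)
      (mem_maximalIdeal_pow_of_le_nu hc0 n.succ_ne_zero hM)
    refine ⟨⟨d, ?_, hdu⟩, hd⟩
    rintro rfl
    exact hc0 (by simpa using hd)
  choose f hf using hroot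
  obtain ⟨a, ha0, hau⟩ := Ring.exists_not_isUnit_of_not_isField hR
  obtain ⟨c, hc0, hc⟩ : ∃ c : ℕ → {x : R // x ≠ 0 ∧ ¬ IsUnit x},
      c 0 = ⟨a, ha0, hau⟩ ∧ ∀ n, c (n + 1) = f n (c n) :=
    ⟨fun n => Nat.rec ⟨a, ha0, hau⟩ f n, rfl, fun _ => rfl⟩
  obtain ⟨M, hM, hmem⟩ := exists_isMaximal_forall_mem_pow (fun n => (c n : R))
    (fun n => (c n).2.2) (fun n => by simpa only [hc] using hf n (c n))
  simp only [hc0] at hmem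
  have hDVR : IsDiscreteValuationRing (Localization.AtPrime M) := hAD ⟨M, hM⟩
  have hinf : algebraMap R (Localization.AtPrime M) a ∈
      ⨅ n : ℕ, IsLocalRing.maximalIdeal (Localization.AtPrime M) ^ n := by
    rw [Ideal.mem_iInf]
    intro n
    rw [← Localization.AtPrime.map_eq_maximalIdeal, ← Ideal.map_pow]
    exact Ideal.mem_map_of_mem _ (hmem n)
  rw [Ideal.iInf_pow_eq_bot_of_isLocalRing _ (IsLocalRing.maximalIdeal.isMaximal _).ne_top,
    Ideal.mem_bot] at hinf
  exact ha0 ((map_eq_zero_iff _ (IsLocalization.injective (Localization.AtPrime M)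
    M.primeCompl_le_nonZeroDivisors)).1 hinf)

end ADPaper
end

section
/- Let D be an almost Dedekind domain that is not a field, and let T := ⋂{D_M : M ∈ Crit^ω(D)} (interpreted as the quotient field of D if Crit^ω(D) = ∅). If the Jacobson radical of T is nonzero, then D is not completely unbounded; that is, there exists a nonzero proper principal ideal of D that is bounded. -/
/-!
Common definitions: almost Dedekind domains, ideal functions, critical ideals,
the constructible topology on the maximal spectrum.
-/

open scoped Classical Topology

namespace ADPaper

open Set

section CommRing

variable {R : Type*} [CommRing R]

theorem isOpen_setOf_notMem (f : R) : IsOpen {M : MaximalSpectrum R | f ∉ M.asIdeal} :=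
  (PrimeSpectrum.basicOpen f).isOpen.preimage MaximalSpectrum.toPrimeSpectrum_continuous

/-- The sets `{N | f ∉ N}` form a neighbourhood basis of the maximal spectrum. -/
theorem exists_notMem_subset_of_isOpen {U : Set (MaximalSpectrum R)} (hU : IsOpen U)
    {M : MaximalSpectrum R} (hM : M ∈ U) :
    ∃ f ∉ M.asIdeal, {N : MaximalSpectrum R | f ∉ N.asIdeal} ⊆ U := by
  obtain ⟨V, hV, rfl⟩ := isOpen_induced_iff.mp hU
  obtain ⟨_, ⟨f, rfl⟩, hf, hfV⟩ :=
    PrimeSpectrum.isTopologicalBasis_basic_opens.exists_subset_of_mem_open hM hV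
  exact ⟨f, hf, fun N hN => hfV hN⟩

theorem compactSpace_maximalSpectrum : CompactSpace (MaximalSpectrum R) := by
  have hind : Topology.IsInducing (MaximalSpectrum.toPrimeSpectrum (R := R)) := ⟨rfl⟩
  rw [← isCompact_univ_iff, hind.isCompact_iff, image_univ]
  refine isCompact_of_finite_subcover fun {ι} U hUo hU => ?_
  obtain ⟨t, ht⟩ := isCompact_univ.elim_finite_subcover U hUo fun p _ => by
    obtain ⟨m, hm, hpm⟩ := Ideal.exists_le_maximal p.asIdeal p.isPrime.ne_top
    obtain ⟨i, hi⟩ := mem_iUnion.mp (hU ⟨⟨m, hm⟩, rfl⟩)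
    refine mem_iUnion.mpr ⟨i, ?_⟩
    refine Specializes.mem_open ?_ (hUo i) hi
    rw [← PrimeSpectrum.le_iff_specializes]
    exact hpm
  exact ⟨t, (subset_univ _).trans ht⟩

/-- A clopen subset of the maximal spectrum of the form `{N | f ∉ N}` is cut out by one element,
namely an element congruent to `1` modulo `f`. -/
theorem exists_mem_iff_notMem_of_isOpen {f : R}
    (hf : IsOpen {M : MaximalSpectrum R | f ∈ M.asIdeal}) :
    ∃ k : R, ∀ N : MaximalSpectrum R, k ∈ N.asIdeal ↔ f ∉ N.asIdeal := by
  set K : Ideal R := Ideal.span {k | ∀ N : MaximalSpectrum R, f ∉ N.asIdeal → k ∈ N.asIdeal}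
  have hK : ∀ k ∈ K, ∀ N : MaximalSpectrum R, f ∉ N.asIdeal → k ∈ N.asIdeal := by
    intro k hk N hN
    have hle : K ≤ N.asIdeal := Ideal.span_le.mpr fun k' hk' => hk' N hN
    exact hle hk
  have htop : Ideal.span {f} ⊔ K = ⊤ := by
    by_contra h
    obtain ⟨m, hm, hle⟩ := Ideal.exists_le_maximal _ h
    have hfm : f ∈ m := hle (le_sup_left (b := K) (Ideal.mem_span_singleton_self f))
    obtain ⟨g, hg, hgU⟩ := exists_notMem_subset_of_isOpen hf (M := ⟨m, hm⟩) hfm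
    refine hg (hle (le_sup_right (a := Ideal.span {f}) (Ideal.subset_span fun N hN => ?_)))
    by_contra h
    exact hN (hgU h)
  obtain ⟨a, ha, k, hk, hak⟩ := Submodule.mem_sup.mp ((Ideal.eq_top_iff_one _).mp htop)
  refine ⟨k, fun N => ⟨fun hkN hfN => ?_, hK k hk N⟩⟩
  refine (Ideal.ne_top_iff_one _).mp N.isMaximal.ne_top ?_
  rw [← hak]
  exact add_mem ((Ideal.span_singleton_le_iff_mem _).mpr hfN ha) hkN

theorem exists_forall_dvd_mul_of_fg (M : MaximalSpectrum R) (y : R) {I : Ideal R} (hI : I.FG)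
    (h : ∀ z ∈ I, ∃ s ∉ M.asIdeal, y ∣ s * z) : ∃ s ∉ M.asIdeal, ∀ z ∈ I, y ∣ s * z := by
  induction I, hI using Submodule.fg_induction with
  | singleton x =>
    obtain ⟨s, hs, hsx⟩ := h x (Submodule.mem_span_singleton_self x)
    refine ⟨s, hs, fun z hz => ?_⟩
    obtain ⟨a, rfl⟩ := Submodule.mem_span_singleton.mp hz
    rw [smul_eq_mul, mul_left_comm]
    exact hsx.mul_left a
  | sup I₁ I₂ _ _ h₁ h₂ =>
    obtain ⟨s, hs, hsx⟩ := h₁ fun z hz => h z (le_sup_left (b := I₂) hz)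
    obtain ⟨t, ht, htx⟩ := h₂ fun z hz => h z (le_sup_right (a := I₁) hz)
    refine ⟨s * t, fun hst => (M.isMaximal.isPrime.mem_or_mem hst).elim hs ht, fun z hz => ?_⟩
    obtain ⟨a, ha, b, hb, rfl⟩ := Submodule.mem_sup.mp hz
    have : s * t * (a + b) = t * (s * a) + s * (t * b) := by ring
    rw [this]
    exact ((hsx a ha).mul_left t).add ((htx b hb).mul_left s)

end CommRing

variable {R : Type*} [CommRing R] [IsDomain R]

/-- The normalized additive valuation of an almost Dedekind domain at a maximal ideal. -/
noncomputable def locVal (hAD : AlmostDedekind R) (M : MaximalSpectrum R) : AddValuation R ℕ∞ :=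
  haveI := hAD M
  (IsDiscreteValuationRing.addVal (Localization.AtPrime M.asIdeal)).comap
    (algebraMap R (Localization.AtPrime M.asIdeal))

theorem natCast_le_addVal_iff {A : Type*} [CommRing A] [IsDomain A] [IsDiscreteValuationRing A]
    {n : ℕ} {x : A} :
    (n : ℕ∞) ≤ IsDiscreteValuationRing.addVal A x ↔ x ∈ IsLocalRing.maximalIdeal A ^ n := by
  obtain ⟨ϖ, hϖ⟩ := IsDiscreteValuationRing.exists_irreducible A
  rw [hϖ.maximalIdeal_eq, Ideal.span_singleton_pow, Ideal.mem_span_singleton,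
    ← IsDiscreteValuationRing.addVal_le_iff_dvd, hϖ.addVal_pow]

theorem natCast_le_locVal_iff (hAD : AlmostDedekind R) {M : MaximalSpectrum R} {n : ℕ} {x : R} :
    (n : ℕ∞) ≤ locVal hAD M x ↔ algebraMap R (Localization.AtPrime M.asIdeal) x ∈
      IsLocalRing.maximalIdeal (Localization.AtPrime M.asIdeal) ^ n :=
  have := hAD M
  natCast_le_addVal_iff

theorem algebraMap_atPrime_injective (M : MaximalSpectrum R) :
    Function.Injective (algebraMap R (Localization.AtPrime M.asIdeal)) :=
  IsLocalization.injective _ M.asIdeal.primeCompl_le_nonZeroDivisors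

theorem locVal_eq_top_iff (hAD : AlmostDedekind R) {M : MaximalSpectrum R} {x : R} :
    locVal hAD M x = ⊤ ↔ x = 0 := by
  have := hAD M
  rw [← map_eq_zero_iff _ (algebraMap_atPrime_injective M)]
  exact IsDiscreteValuationRing.addVal_eq_top_iff

theorem locVal_eq_zero_iff (hAD : AlmostDedekind R) {M : MaximalSpectrum R} {x : R} :
    locVal hAD M x = 0 ↔ x ∉ M.asIdeal := by
  have := hAD M
  rw [← Ideal.mem_primeCompl_iff, ← IsLocalization.AtPrime.isUnit_to_map_iff
    (Localization.AtPrime M.asIdeal) M.asIdeal]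
  exact IsDiscreteValuationRing.addVal_eq_zero_iff

theorem one_le_locVal_iff (hAD : AlmostDedekind R) {M : MaximalSpectrum R} {x : R} :
    1 ≤ locVal hAD M x ↔ x ∈ M.asIdeal := by
  rw [Order.one_le_iff_ne_zero, Ne, locVal_eq_zero_iff, not_not]

theorem elemVal_eq_locVal (hAD : AlmostDedekind R) {M : MaximalSpectrum R} {x : R} (hx : x ≠ 0) :
    (elemVal R M x : ℕ∞) = locVal hAD M x := by
  obtain ⟨k, hk⟩ := ENat.ne_top_iff_exists.mp (mt (locVal_eq_top_iff hAD (M := M)).mp hx)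
  have : elemVal R M x = k := by
    unfold elemVal
    simp_rw [← natCast_le_locVal_iff hAD, ← hk, Nat.cast_le]
    exact csSup_Iic
  rw [this, hk]

theorem nu_le_of_locVal_le (hAD : AlmostDedekind R) {M : MaximalSpectrum R} {I : Ideal R}
    {x : R} (hxI : x ∈ I) {n : ℕ} (h : locVal hAD M x ≤ n) : nu R I M ≤ n := by
  have hx : x ≠ 0 := by
    rintro rfl
    rw [(locVal_eq_top_iff hAD).mpr rfl] at h
    exact absurd (top_le_iff.mp h) (ENat.natCast_ne_top n)
  rw [← elemVal_eq_locVal hAD hx, Nat.cast_le] at h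
  have hmem : x ∈ {x | x ∈ I ∧ x ≠ 0} := ⟨hxI, hx⟩
  exact (Nat.sInf_le (mem_image_of_mem _ hmem)).trans h

theorem exists_locVal_le_of_nu_le (hAD : AlmostDedekind R) {M : MaximalSpectrum R} {I : Ideal R}
    (hI : I ≠ ⊥) {n : ℕ} (h : nu R I M ≤ n) : ∃ x ∈ I, locVal hAD M x ≤ n := by
  obtain ⟨z, hz⟩ := Submodule.exists_mem_ne_zero_of_ne_bot hI
  obtain ⟨x, ⟨hxI, hx⟩, hxv⟩ := Nat.sInf_mem (s := elemVal R M '' {x | x ∈ I ∧ x ≠ 0})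
    ⟨_, mem_image_of_mem _ hz⟩
  refine ⟨x, hxI, ?_⟩
  rw [← elemVal_eq_locVal hAD hx, hxv]
  exact_mod_cast h

theorem exists_dvd_mul_of_locVal_le (hAD : AlmostDedekind R) {M : MaximalSpectrum R} {y z : R}
    (h : locVal hAD M y ≤ locVal hAD M z) : ∃ s ∉ M.asIdeal, y ∣ s * z := by
  have := hAD M
  obtain ⟨c, hc⟩ := IsDiscreteValuationRing.addVal_le_iff_dvd.mp h
  obtain ⟨a, s, rfl⟩ := IsLocalization.exists_mk'_eq M.asIdeal.primeCompl c
  refine ⟨s, s.2, a, algebraMap_atPrime_injective M ?_⟩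
  rw [map_mul, map_mul, hc, mul_left_comm, IsLocalization.mk'_spec'_mk]

/-- If `J` is finitely generated and `J ≤ M`, then locally at `M` some power of every element of
`J`, with uniform exponent, is divisible by a given nonzero `y`. -/
theorem exists_dvd_mul_pow_of_fg_le (hAD : AlmostDedekind R) {M : MaximalSpectrum R} {J : Ideal R}
    (hJ : J.FG) (hJM : J ≤ M.asIdeal) {y : R} (hy : y ≠ 0) :
    ∃ s ∉ M.asIdeal, ∃ k : ℕ, ∀ z ∈ J, y ∣ s * z ^ k := by
  obtain ⟨k, hk⟩ := ENat.ne_top_iff_exists.mp (mt (locVal_eq_top_iff hAD (M := M)).mp hy)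
  obtain ⟨s, hs, h⟩ := exists_forall_dvd_mul_of_fg M y (Submodule.FG.pow hJ k) fun z hz => by
    refine exists_dvd_mul_of_locVal_le hAD (M := M) ?_
    rw [← hk, natCast_le_locVal_iff, ← Localization.AtPrime.map_eq_maximalIdeal, ← Ideal.map_pow]
    exact Ideal.mem_map_of_mem _ (Ideal.pow_right_mono hJM k hz)
  exact ⟨s, hs, k, fun z hz => h _ (Ideal.pow_mem_pow hz k)⟩

theorem locVal_le_of_dvd_mul_pow (hAD : AlmostDedekind R) {N : MaximalSpectrum R} {s y z : R}
    {k n : ℕ} (hs : s ∉ N.asIdeal) (h : y ∣ s * z ^ k) (hz : locVal hAD N z ≤ n) :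
    locVal hAD N y ≤ ((k * n : ℕ) : ℕ∞) := by
  obtain ⟨a, ha⟩ := h
  calc locVal hAD N y ≤ locVal hAD N (y * a) := by
        rw [AddValuation.map_mul]; exact le_self_add
    _ = k • locVal hAD N z := by
        rw [← ha, AddValuation.map_mul, AddValuation.map_pow, (locVal_eq_zero_iff hAD).mpr hs,
          zero_add]
    _ ≤ k • (n : ℕ∞) := nsmul_le_nsmul_right hz k
    _ = ((k * n : ℕ) : ℕ∞) := by rw [nsmul_eq_mul, Nat.cast_mul]

/-- A nonzero element lying in no `ω`-critical maximal ideal is bounded. -/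
theorem exists_locVal_le_of_notMem_critOmega (hAD : AlmostDedekind R) {y : R} (hy : y ≠ 0)
    (h : ∀ M ∈ CritOmega R, y ∉ M.asIdeal) : ∃ n : ℕ, ∀ M, locVal hAD M y ≤ n := by
  have := compactSpace_maximalSpectrum (R := R)
  suffices H : ∃ n : ℕ, ∀ M ∈ (univ : Set (MaximalSpectrum R)), locVal hAD M y ≤ n by
    simpa using H
  refine isCompact_univ.induction_on (p := fun S => ∃ n : ℕ, ∀ M ∈ S, locVal hAD M y ≤ n)
    ⟨0, by simp⟩ (fun S T hST ⟨n, hn⟩ => ⟨n, fun M hM => hn M (hST hM)⟩) ?_ fun M _ => ?_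
  · rintro S T ⟨m, hm⟩ ⟨n, hn⟩
    refine ⟨max m n, ?_⟩
    rintro M (hM | hM)
    · exact (hm M hM).trans (Nat.cast_le.mpr (le_max_left m n))
    · exact (hn M hM).trans (Nat.cast_le.mpr (le_max_right m n))
  · simp only [nhdsWithin_univ]
    by_cases hyM : y ∈ M.asIdeal
    · have hM : M ∉ CritOmega R := fun hM => h M hM hyM
      simp only [CritOmega, mem_ofPred_eq, not_forall, not_not] at hM
      obtain ⟨J, hJ, hfg, ⟨n, hn⟩, hJM⟩ := hM
      obtain ⟨s, hs, k, hk⟩ := exists_dvd_mul_pow_of_fg_le hAD hfg hJM hy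
      refine ⟨_, (isOpen_setOf_notMem s).mem_nhds hs, k * n, fun N hN => ?_⟩
      obtain ⟨z, hzJ, hz⟩ := exists_locVal_le_of_nu_le hAD hJ (hn N)
      exact locVal_le_of_dvd_mul_pow hAD hN (hk z hzJ) hz
    · exact ⟨_, (isOpen_setOf_notMem y).mem_nhds hyM, 0, fun N hN =>
        ((locVal_eq_zero_iff hAD).mpr hN).le⟩

theorem exists_forall_notMem_or_mem (hAD : AlmostDedekind R) {x : R} (hx0 : x ≠ 0)
    (hx : ∀ M : MaximalSpectrum R, x ∈ M.asIdeal)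
    {M : MaximalSpectrum R} {z : R} (hz : z ∈ M.asIdeal) :
    ∃ s ∉ M.asIdeal, ∀ N : MaximalSpectrum R, s ∉ N.asIdeal → z ∈ N.asIdeal := by
  obtain ⟨s, hs, k, h⟩ := exists_dvd_mul_pow_of_fg_le hAD (Submodule.fg_span_singleton z)
    ((Ideal.span_singleton_le_iff_mem _).mpr hz) hx0
  refine ⟨s, hs, fun N hN => ?_⟩
  have := N.isMaximal.isPrime
  have hzk := Ideal.mem_of_dvd _ (h z (Ideal.mem_span_singleton_self z)) (hx N)
  exact this.mem_of_pow_mem k ((this.mem_or_mem hzk).resolve_left hN)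

theorem isOpen_setOf_mem (hAD : AlmostDedekind R) {x : R} (hx0 : x ≠ 0)
    (hx : ∀ M : MaximalSpectrum R, x ∈ M.asIdeal) (z : R) :
    IsOpen {M : MaximalSpectrum R | z ∈ M.asIdeal} := by
  refine isOpen_iff_mem_nhds.mpr fun M hM => ?_
  obtain ⟨s, hs, h⟩ := exists_forall_notMem_or_mem hAD hx0 hx hM
  exact Filter.mem_of_superset ((isOpen_setOf_notMem s).mem_nhds hs) h

theorem t2Space_maximalSpectrum (hAD : AlmostDedekind R) {x : R} (hx0 : x ≠ 0)
    (hx : ∀ M : MaximalSpectrum R, x ∈ M.asIdeal) : T2Space (MaximalSpectrum R) := by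
  refine ⟨fun M N hMN => ?_⟩
  obtain ⟨z, hzM, hzN⟩ : ∃ z ∈ M.asIdeal, z ∉ N.asIdeal := by
    by_contra! h
    exact hMN (MaximalSpectrum.ext (M.isMaximal.eq_of_le N.isMaximal.ne_top h))
  exact ⟨_, _, isOpen_setOf_mem hAD hx0 hx z, isOpen_setOf_notMem z, hzM, hzN,
    disjoint_left.mpr fun _ h₁ h₂ => h₂ h₁⟩

theorem isClosed_setOf_locVal_le (hAD : AlmostDedekind R) {x : R} (hx0 : x ≠ 0)
    (hx : ∀ M : MaximalSpectrum R, x ∈ M.asIdeal) (n : ℕ) :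
    IsClosed {M | locVal hAD M x ≤ n} := by
  rw [← isOpen_compl_iff, isOpen_iff_mem_nhds]
  intro M hM
  obtain ⟨k, hk⟩ := ENat.ne_top_iff_exists.mp (mt (locVal_eq_top_iff hAD (M := M)).mp hx0)
  have := hAD M
  obtain ⟨t, ht⟩ : ∃ t, locVal hAD M t = 1 := by
    obtain ⟨ϖ, hϖ⟩ :=
      IsDiscreteValuationRing.exists_irreducible (Localization.AtPrime M.asIdeal)
    obtain ⟨a, s, rfl⟩ := IsLocalization.exists_mk'_eq M.asIdeal.primeCompl ϖ
    refine ⟨a, ?_⟩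
    change IsDiscreteValuationRing.addVal _ _ = _
    rw [← IsLocalization.mk'_spec' _ a s, IsDiscreteValuationRing.addVal_mul,
      IsDiscreteValuationRing.addVal_uniformizer hϖ, IsDiscreteValuationRing.addVal_eq_zero_iff.mpr
      (IsLocalization.map_units _ s), zero_add]
  obtain ⟨s, hs, c, hc⟩ := exists_dvd_mul_of_locVal_le hAD (M := M) (y := t ^ k) (z := x) (by
    rw [AddValuation.map_pow, ht, nsmul_one, hk])
  have htM : t ∈ M.asIdeal := (one_le_locVal_iff hAD).mp ht.ge
  filter_upwards [(isOpen_setOf_notMem s).mem_nhds hs,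
    (isOpen_setOf_mem hAD hx0 hx t).mem_nhds htM] with N hsN htN
  simp only [mem_compl_iff, mem_ofPred_eq, not_le, ← hk] at hM ⊢
  refine hM.trans_le ?_
  calc (k : ℕ∞) = k • 1 := (nsmul_one k).symm
    _ ≤ k • locVal hAD N t := nsmul_le_nsmul_right ((one_le_locVal_iff hAD).mpr htN) k
    _ ≤ locVal hAD N (t ^ k * c) := by
        rw [AddValuation.map_mul, AddValuation.map_pow]; exact le_self_add
    _ = locVal hAD N x := by
        rw [← hc, AddValuation.map_mul, (locVal_eq_zero_iff hAD).mpr hsN, zero_add]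

/-- An almost Dedekind domain with nonzero Jacobson radical has a bounded nonzero nonunit. -/
theorem exists_bounded_of_forall_mem (hAD : AlmostDedekind R) {x : R} (hx0 : x ≠ 0)
    (hx : ∀ M : MaximalSpectrum R, x ∈ M.asIdeal) :
    ∃ e : R, (∃ M : MaximalSpectrum R, e ∈ M.asIdeal) ∧
      ∃ n : ℕ, ∀ M, locVal hAD M e ≤ n := by
  have := compactSpace_maximalSpectrum (R := R)
  have := t2Space_maximalSpectrum hAD hx0 hx
  obtain ⟨n, M, hM⟩ := nonempty_interior_of_iUnion_of_closed
    (isClosed_setOf_locVal_le hAD hx0 hx) (iUnion_eq_univ_iff.mpr fun M => by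
      obtain ⟨k, hk⟩ := ENat.ne_top_iff_exists.mp (mt (locVal_eq_top_iff hAD (M := M)).mp hx0)
      exact ⟨k, hk.ge⟩)
  obtain ⟨f, hfM, hf⟩ := exists_notMem_subset_of_isOpen isOpen_interior hM
  obtain ⟨k, hk⟩ := exists_mem_iff_notMem_of_isOpen (isOpen_setOf_mem hAD hx0 hx f)
  refine ⟨x + k ^ (n + 1), ⟨M, add_mem (hx M)
    (Ideal.pow_mem_of_mem _ ((hk M).mpr hfM) _ n.succ_pos)⟩, n, fun N => ?_⟩
  by_cases hfN : f ∈ N.asIdeal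
  · have hkN : k ∉ N.asIdeal := fun h => (hk N).mp h hfN
    have : x + k ^ (n + 1) ∉ N.asIdeal := fun h =>
      hkN (N.isMaximal.isPrime.mem_of_pow_mem _ ((add_mem_cancel_left (hx N)).mp h))
    rw [(locVal_eq_zero_iff hAD).mpr this]
    exact zero_le
  · have hxN : N ∈ {M | locVal hAD M x ≤ n} := interior_subset (hf hfN)
    rw [mem_ofPred_eq] at hxN
    by_contra! hlt
    have hle : ((n + 1 : ℕ) : ℕ∞) ≤ locVal hAD N (k ^ (n + 1)) := by
      rw [AddValuation.map_pow, ← nsmul_one]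
      exact nsmul_le_nsmul_right ((one_le_locVal_iff hAD).mpr ((hk N).mpr hfN)) _
    have hle' : ((n + 1 : ℕ) : ℕ∞) ≤ locVal hAD N (x + k ^ (n + 1)) := by
      rw [Nat.cast_add_one]; exact Order.add_one_le_of_lt hlt
    have h := (le_min hle' hle).trans ((locVal hAD N).map_sub _ _)
    rw [add_sub_cancel_right] at h
    exact absurd (Nat.cast_le.mp (h.trans hxN)) (by omega)

theorem notMem_of_isUnit_interLoc {X : Set (MaximalSpectrum R)} {y : R}
    (hy : IsUnit (algebraMap R (interLoc R X) y)) {M : MaximalSpectrum R} (hM : M ∈ X) :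
    y ∉ M.asIdeal := by
  have hle : interLoc R X ≤ locSubalgebra R M := iInf₂_le M hM
  have hu : IsUnit (algebraMap R (locSubalgebra R M) y) := by
    simpa using hy.map (Subalgebra.inclusion hle)
  have : IsLocalization.AtPrime (locSubalgebra R M) M.asIdeal :=
    Localization.subalgebra.isLocalization_subalgebra _ _ _
  exact (IsLocalization.AtPrime.isUnit_to_map_iff (locSubalgebra R M) M.asIdeal y).mp hu

theorem exists_ne_zero_algebraMap_mem {K : Type*} [Field K] [Algebra R K] [IsFractionRing R K]
    {T : Subalgebra R K} {I : Ideal T} (hI : I ≠ ⊥) :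
    ∃ x : R, x ≠ 0 ∧ algebraMap R T x ∈ I := by
  obtain ⟨z, hzI, hz⟩ := Submodule.exists_mem_ne_zero_of_ne_bot hI
  obtain ⟨a, s, hs, has⟩ := IsFractionRing.div_surjective (A := R) (z : K)
  have hs0 : algebraMap R K s ≠ 0 :=
    IsFractionRing.to_map_ne_zero_of_mem_nonZeroDivisors hs
  have key : algebraMap R T a = algebraMap R T s * z := by
    apply Subtype.ext
    change algebraMap R K a = algebraMap R K s * z
    rw [← has, mul_div_cancel₀ _ hs0]
  refine ⟨a, ?_, key ▸ I.mul_mem_left _ hzI⟩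
  rintro rfl
  rw [map_zero, zero_div] at has
  exact hz (Subtype.ext has.symm)

end ADPaper

namespace ADPaper

/-- Let `D` be an almost Dedekind domain (not a field) and
`T = ⋂ {D_M : M ∈ Critʷ(D)}` (the fraction field when `Critʷ(D) = ∅`). If the Jacobson
radical of `T` is nonzero, then `D` is not completely unbounded: some nonzero proper
principal ideal of `D` is bounded. -/
theorem statement12 (R : Type*) [CommRing R] [IsDomain R] (hR : ¬ IsField R)
    (hAD : AlmostDedekind R)
    (hJ : Ideal.jacobson (⊥ : Ideal (interLoc R (CritOmega R))) ≠ ⊥) :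
    ∃ a : R, Ideal.span {a} ≠ ⊥ ∧ Ideal.span {a} ≠ ⊤ ∧
      ∃ n : ℕ, ∀ M, nu R (Ideal.span {a}) M ≤ n := by
  obtain ⟨e, ⟨M, heM⟩, n, hn⟩ : ∃ e : R, (∃ M : MaximalSpectrum R, e ∈ M.asIdeal) ∧
      ∃ n : ℕ, ∀ M, locVal hAD M e ≤ n := by
    obtain ⟨x, hx0, hxJ⟩ := exists_ne_zero_algebraMap_mem hJ
    have hunit : ∀ d : R, IsUnit (algebraMap R (interLoc R (CritOmega R)) (x * d + 1)) := by
      intro d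
      simpa using Ideal.mem_jacobson_bot.mp hxJ (algebraMap R _ d)
    by_cases h : ∀ d : R, IsUnit (x * d + 1)
    · refine exists_bounded_of_forall_mem hAD hx0 fun M => ?_
      exact (Ideal.mem_sInf.mp (Ideal.mem_jacobson_bot.mpr h)) ⟨bot_le, M.isMaximal⟩
    · push Not at h
      obtain ⟨d, hd⟩ := h
      obtain ⟨m, hm, hdm⟩ := exists_max_ideal_of_mem_nonunits hd
      refine ⟨x * d + 1, ⟨⟨m, hm⟩, hdm⟩, exists_locVal_le_of_notMem_critOmega hAD ?_
        fun M hM => notMem_of_isUnit_interLoc (hunit d) hM⟩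
      intro h0
      have := hunit d
      rw [h0, map_zero] at this
      exact not_isUnit_zero this
  refine ⟨e, ?_, ?_, n, fun N => nu_le_of_locVal_le hAD (Ideal.mem_span_singleton_self e) (hn N)⟩
  · rw [Ne, Ideal.span_singleton_eq_bot, ← locVal_eq_top_iff hAD (M := M)]
    intro h
    exact absurd (top_le_iff.mp (h ▸ hn M)) (ENat.natCast_ne_top n)
  · intro h
    exact M.isMaximal.ne_top (top_le_iff.mp
      (h ▸ (Ideal.span_singleton_le_iff_mem _).mpr heM))

end ADPaper
end

section
/- Let D be an almost Dedekind domain that is not a field with nonzero Jacobson radical. Then D is not completely unbounded; that is, there exists a nonzero proper principal ideal of D that is bounded. -/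
/-!
Common definitions: almost Dedekind domains, ideal functions, critical ideals,
the constructible topology on the maximal spectrum.
-/

open scoped Classical Topology

namespace ADPaper

/-- In a zero-dimensional ring, every element is strongly π-regular. -/
theorem exists_pow_mul_one_sub_eq_zero {A : Type*} [CommRing A] [Ring.KrullDimLE 0 A] (x : A) :
    ∃ (m : ℕ) (z : A), x ^ m * (1 - x * z) = 0 := by
  let S : Submonoid A :=
    { carrier := {y | ∃ (m : ℕ) (z : A), x ^ m * (1 - x * z) = y}
      one_mem' := ⟨0, 0, by simp⟩
      mul_mem' := by
        rintro _ _ ⟨m, z, rfl⟩ ⟨k, w, rfl⟩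
        exact ⟨m + k, z + w - x * z * w, by ring⟩ }
  by_contra h
  have hdisj : Disjoint ((⊥ : Ideal A) : Set A) (S : Set A) := by
    rw [Set.disjoint_left]
    rintro y hy hyS
    obtain rfl : y = 0 := by simpa using hy
    exact h hyS
  obtain ⟨p, hp, -, hpS⟩ := Ideal.exists_le_prime_disjoint ⊥ S hdisj
  have hpm : p.IsMaximal := hp.isMaximal'
  rw [Set.disjoint_left] at hpS
  have hx : x ∉ p := fun hx => hpS hx ⟨1, 0, by simp⟩
  obtain ⟨z, hz⟩ := hpm.exists_inv hx
  obtain ⟨i, hi, hzi⟩ := hz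
  refine hpS hi ⟨0, z, ?_⟩
  rw [← hzi]
  ring

/-- Basic open sets of the spectrum of a zero-dimensional ring are clopen. -/
theorem isClopen_basicOpen_of_krullDimLE_zero {A : Type*} [CommRing A] [Ring.KrullDimLE 0 A]
    (x : A) : IsClopen (PrimeSpectrum.basicOpen x : Set (PrimeSpectrum A)) := by
  refine ⟨?_, (PrimeSpectrum.basicOpen x).isOpen⟩
  obtain ⟨m, z, hz⟩ := exists_pow_mul_one_sub_eq_zero x
  rw [← isOpen_compl_iff]
  convert (PrimeSpectrum.basicOpen (1 - x * z)).isOpen using 1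
  ext p
  simp only [Set.mem_compl_iff, SetLike.mem_coe, PrimeSpectrum.mem_basicOpen, not_not]
  constructor
  · intro hx h
    refine p.2.ne_top ((Ideal.eq_top_iff_one _).2 ?_)
    simpa using add_mem h (p.asIdeal.mul_mem_right z hx)
  · intro h
    have h0 : x ^ m * (1 - x * z) ∈ p.asIdeal := by simp [hz]
    exact p.2.mem_of_pow_mem _ ((p.2.mem_or_mem h0).resolve_right h)

theorem totallySeparatedSpace_primeSpectrum_of_krullDimLE_zero (A : Type*) [CommRing A]
    [Ring.KrullDimLE 0 A] : TotallySeparatedSpace (PrimeSpectrum A) := by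
  rw [totallySeparatedSpace_iff_exists_isClopen]
  intro p q hpq
  have hle : ¬ q.asIdeal ≤ p.asIdeal := fun h =>
    hpq (PrimeSpectrum.ext ((q.2.isMaximal').eq_of_le p.2.ne_top h).symm)
  obtain ⟨x, hxq, hxp⟩ := SetLike.not_le_iff_exists.1 hle
  exact ⟨_, isClopen_basicOpen_of_krullDimLE_zero x, hxp, fun h => h hxq⟩

section Localization

variable {R : Type*} [CommRing R] [IsDomain R]

/-- Nonzero primes of an almost Dedekind domain are maximal. -/
theorem AlmostDedekind.isMaximal (hAD : AlmostDedekind R) {P : Ideal R} (hP : P.IsPrime)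
    (h0 : P ≠ ⊥) : P.IsMaximal := by
  obtain ⟨M, hM, hPM⟩ := Ideal.exists_le_maximal P hP.ne_top
  have := hAD ⟨M, hM⟩
  have hprime := Ideal.isPrime_map_of_isLocalizationAtPrime M
    (S := Localization.AtPrime M) hPM
  have hunder := Ideal.under_map_of_isLocalizationAtPrime M
    (S := Localization.AtPrime M) hPM
  have hne : P.map (algebraMap R (Localization.AtPrime M)) ≠ ⊥ := by
    rwa [Ne, Ideal.map_eq_bot_iff_of_injective
      (IsLocalization.injective _ M.primeCompl_le_nonZeroDivisors)]
  have hmax := IsLocalRing.eq_maximalIdeal (hprime.isMaximal hne)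
  rw [hmax, IsLocalization.AtPrime.under_maximalIdeal _ M] at hunder
  exact hunder ▸ hM

theorem AlmostDedekind.krullDimLE_zero_quotient (hAD : AlmostDedekind R) {a : R} (ha : a ≠ 0) :
    Ring.KrullDimLE 0 (R ⧸ Ideal.span {a}) := by
  refine .mk₀ fun P hP => ?_
  have hmax : (P.comap (Ideal.Quotient.mk (Ideal.span {a}))).IsMaximal := by
    refine hAD.isMaximal (hP.comap _) fun h => ha ?_
    have hmem : a ∈ P.comap (Ideal.Quotient.mk (Ideal.span {a})) := by
      rw [Ideal.mem_comap, Ideal.Quotient.eq_zero_iff_mem.2 (Ideal.mem_span_singleton_self a)]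
      exact P.zero_mem
    rwa [h] at hmem
  rw [← Ideal.map_comap_of_surjective _ Ideal.Quotient.mk_surjective P]
  exact Ideal.IsMaximal.map_of_surjective_of_ker_le Ideal.Quotient.mk_surjective
    (Ideal.ker_le_comap _)

theorem AlmostDedekind.exists_notMem_pow (hAD : AlmostDedekind R) {M : Ideal R}
    (hM : M.IsMaximal) {a : R} (ha : a ≠ 0) : ∃ n : ℕ, a ∉ M ^ n := by
  by_contra! h
  have := hAD ⟨M, hM⟩
  refine ha (IsLocalization.injective (Localization.AtPrime M)
    M.primeCompl_le_nonZeroDivisors ?_)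
  rw [map_zero, ← Ideal.mem_bot, ← Ideal.iInf_pow_eq_bot_of_isLocalRing _
    (IsLocalRing.maximalIdeal.isMaximal (Localization.AtPrime M)).ne_top, Ideal.mem_iInf]
  intro n
  have hn := h n
  rwa [← IsLocalization.AtPrime.under_maximalIdeal_pow M (Localization.AtPrime M)] at hn

/-- If `a ∈ M ^ n`, then locally at `M`, and hence near `M`, `a` is a multiple of `c ^ n`
for some `c ∈ M`. -/
theorem AlmostDedekind.exists_pow_dvd_mul (hAD : AlmostDedekind R) {M : Ideal R}
    (hM : M.IsMaximal) {a : R} {n : ℕ} (ha : a ∈ M ^ n) :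
    ∃ c ∈ M, ∃ s ∉ M, c ^ n ∣ s * a := by
  have := hAD ⟨M, hM⟩
  obtain ⟨ϖ, hϖ⟩ := IsDiscreteValuationRing.exists_irreducible (Localization.AtPrime M)
  obtain ⟨c, u, rfl⟩ := IsLocalization.exists_mk'_eq M.primeCompl ϖ
  have hmem := hϖ.not_isUnit
  rw [IsLocalization.AtPrime.isUnit_mk'_iff _ M, Ideal.mem_primeCompl_iff, not_not] at hmem
  rw [← IsLocalization.AtPrime.under_maximalIdeal_pow M (Localization.AtPrime M),
    Ideal.under_def, Ideal.mem_comap, hϖ.maximalIdeal_eq, Ideal.span_singleton_pow,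
    Ideal.mem_span_singleton] at ha
  obtain ⟨y, hy⟩ := ha
  obtain ⟨t, v, rfl⟩ := IsLocalization.exists_mk'_eq M.primeCompl y
  refine ⟨c, hmem, u ^ n * v, (u ^ n * v).2, t, ?_⟩
  apply IsLocalization.injective (Localization.AtPrime M) M.primeCompl_le_nonZeroDivisors
  have hu := IsLocalization.mk'_spec (Localization.AtPrime M) c u
  have hv := IsLocalization.mk'_spec (Localization.AtPrime M) t v
  simp only [map_mul, map_pow, ← hu, ← hv, hy]
  ring

end Localization

/-- The valuation of `x` at `M` is at most `n` when `x ∉ M ^ (n + 1)`. -/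
theorem nu_span_singleton_le {R : Type*} [CommRing R] (M : MaximalSpectrum R) {x : R} {n : ℕ}
    (hx : x ∉ M.asIdeal ^ (n + 1)) : nu R (Ideal.span {x}) M ≤ n := by
  have hx0 : x ≠ 0 := fun h => hx (h ▸ zero_mem _)
  have hle : nu R (Ideal.span {x}) M ≤ elemVal R M x :=
    Nat.sInf_le ⟨x, ⟨Ideal.mem_span_singleton_self x, hx0⟩, rfl⟩
  refine hle.trans ?_
  refine csSup_le ⟨0, by simp⟩ fun k hk => ?_
  by_contra! hlt
  have := M.isMaximal
  refine hx (Ideal.pow_le_pow_right hlt ?_)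
  rwa [← IsLocalization.AtPrime.under_maximalIdeal_pow M.asIdeal
    (Localization.AtPrime M.asIdeal)]

/-- If `e` is idempotent modulo `a`, then near the zeros of `e` the element
`e ^ 2 + a * (1 - e)` has the same valuation as `a`. -/
theorem mem_pow_of_sq_add_mem_pow {R : Type*} [CommRing R] {M : Ideal R} (hM : M.IsMaximal)
    {a e : R} (haM : a ∈ M) (he : a ∣ e * (1 - e)) (heM : e ∈ M) {n : ℕ}
    (h : e ^ 2 + a * (1 - e) ∈ M ^ n) : a ∈ M ^ n := by
  obtain ⟨r, hr⟩ := he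
  have hmul : (a * r ^ 2 + (1 - e) ^ 3) * a ∈ M ^ n := by
    convert (M ^ n).mul_mem_left ((1 - e) ^ 2) h using 1
    linear_combination (-(e * (1 - e)) - a * r) * hr
  refine (Ideal.IsMaximal.mul_mem_pow M hmul).resolve_left fun hmem => ?_
  have h1 : 1 - e ∈ M :=
    hM.isPrime.mem_of_pow_mem 3 ((Ideal.add_mem_iff_right _ (M.mul_mem_right _ haM)).1 hmem)
  exact hM.ne_top ((Ideal.eq_top_iff_one _).2 (by simpa using add_mem h1 heM))

/-- Let `D` be an almost Dedekind domain (not a field) with nonzero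
Jacobson radical. Then `D` is not completely unbounded: some nonzero proper principal
ideal of `D` is bounded. -/
theorem statement14 (R : Type*) [CommRing R] [IsDomain R] (hR : ¬ IsField R)
    (hAD : AlmostDedekind R) (hJ : Ideal.jacobson (⊥ : Ideal R) ≠ ⊥) :
    ∃ a : R, Ideal.span {a} ≠ ⊥ ∧ Ideal.span {a} ≠ ⊤ ∧
      ∃ n : ℕ, ∀ M, nu R (Ideal.span {a}) M ≤ n := by
  obtain ⟨a, haJ, ha0⟩ := Submodule.exists_mem_ne_zero_of_ne_bot hJ
  have haM (M : Ideal R) (hM : M.IsMaximal) : a ∈ M :=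
    Ideal.mem_sInf.1 haJ ⟨bot_le, hM⟩
  let π := Ideal.Quotient.mk (Ideal.span {a})
  have hdim := hAD.krullDimLE_zero_quotient ha0
  have hsep := totallySeparatedSpace_primeSpectrum_of_krullDimLE_zero (R ⧸ Ideal.span {a})
  have hmax (p : PrimeSpectrum (R ⧸ Ideal.span {a})) : (p.asIdeal.comap π).IsMaximal :=
    have := p.2.isMaximal'
    Ideal.comap_isMaximal_of_surjective _ Ideal.Quotient.mk_surjective
  have hnontriv : Nontrivial (R ⧸ Ideal.span {a}) := by
    obtain ⟨M, hM⟩ := Ideal.exists_maximal R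
    refine Ideal.Quotient.nontrivial_iff.2 fun h => hM.ne_top (top_le_iff.1 ?_)
    rw [← h, Ideal.span_singleton_le_iff_mem]
    exact haM M hM
  have hclosed (n : ℕ) : IsClosed {p : PrimeSpectrum (R ⧸ Ideal.span {a}) |
      a ∉ (p.asIdeal.comap π) ^ (n + 1)} := by
    rw [← isOpen_compl_iff, isOpen_iff_mem_nhds]
    intro p hp
    obtain ⟨c, hc, s, hs, hdvd⟩ := hAD.exists_pow_dvd_mul (hmax p) (not_not.1 hp)
    filter_upwards [(isClopen_basicOpen_of_krullDimLE_zero (π c)).compl.isOpen.mem_nhds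
      (not_not.2 hc), (PrimeSpectrum.basicOpen (π s)).isOpen.mem_nhds hs] with q hcq hsq
    have := hmax q
    have hcq' : c ∈ q.asIdeal.comap π := not_not.1 hcq
    exact not_not.2 ((Ideal.IsMaximal.mul_mem_pow _ (Ideal.mem_of_dvd _ hdvd
      (Ideal.pow_mem_pow hcq' _))).resolve_left hsq)
  obtain ⟨n, p, hp⟩ := nonempty_interior_of_iUnion_of_closed hclosed <| by
    refine Set.eq_univ_of_forall fun p => Set.mem_iUnion.2 ?_
    obtain ⟨n, hn⟩ := hAD.exists_notMem_pow (hmax p) ha0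
    exact ⟨n, fun h => hn (Ideal.pow_le_pow_right n.le_succ h)⟩
  obtain ⟨V, hV, hpV, hVsub⟩ := compact_exists_isClopen_in_isOpen isOpen_interior hp
  obtain ⟨e', he', rfl⟩ := PrimeSpectrum.isClopen_iff_zeroLocus.1 hV
  obtain ⟨e, rfl⟩ := Ideal.Quotient.mk_surjective e'
  have he : a ∣ e * (1 - e) := by
    rw [← Ideal.mem_span_singleton, ← Ideal.Quotient.eq_zero_iff_mem, map_mul, map_sub, map_one,
      mul_sub, mul_one, he'.eq, sub_self]
  have hep : e ∈ p.asIdeal.comap π := by simpa using hpV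
  have hbound (M : MaximalSpectrum R) : e ^ 2 + a * (1 - e) ∉ M.asIdeal ^ (n + 1) := by
    intro hf
    have haM' := haM M.asIdeal M.isMaximal
    have heM : e ∈ M.asIdeal := M.isMaximal.isPrime.mem_of_pow_mem 2
      ((Ideal.add_mem_iff_left _ (M.asIdeal.mul_mem_right _ haM')).1
        (Ideal.pow_le_self n.succ_ne_zero hf))
    have hker : RingHom.ker π ≤ M.asIdeal := by
      rwa [Ideal.mk_ker, Ideal.span_singleton_le_iff_mem]
    have hcomap : (M.asIdeal.map π).comap π = M.asIdeal := by
      rw [Ideal.comap_map_of_surjective' _ Ideal.Quotient.mk_surjective, sup_eq_left.2 hker]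
    have hprime : (M.asIdeal.map π).IsPrime :=
      have := M.isMaximal.isPrime
      Ideal.map_isPrime_of_surjective Ideal.Quotient.mk_surjective hker
    have hq : (⟨M.asIdeal.map π, hprime⟩ : PrimeSpectrum (R ⧸ Ideal.span {a})) ∈
        PrimeSpectrum.zeroLocus {π e} := by
      simpa using Ideal.mem_map_of_mem π heM
    have hnot : a ∉ ((M.asIdeal.map π).comap π) ^ (n + 1) := interior_subset (hVsub hq)
    rw [hcomap] at hnot
    exact hnot (mem_pow_of_sq_add_mem_pow M.isMaximal haM' he heM hf)
  refine ⟨e ^ 2 + a * (1 - e), ?_, ?_, n, fun M => nu_span_singleton_le M (hbound M)⟩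
  · rw [Ne, Ideal.span_singleton_eq_bot]
    exact fun h => hbound ⟨_, hmax p⟩ (h ▸ zero_mem _)
  · refine fun h => (hmax p).ne_top (top_le_iff.1 ?_)
    rw [← h, Ideal.span_singleton_le_iff_mem]
    exact add_mem (Ideal.pow_mem_of_mem _ hep 2 two_pos)
      (Ideal.mul_mem_right _ _ (haM _ (hmax p)))

end ADPaper
end

section
/- Let D be an almost Dedekind domain that is not a Dedekind domain. If D is atomic (every nonzero nonunit of D is a finite product of irreducible elements), then the Jacobson radical of D is zero. -/
/-!
Common definitions: almost Dedekind domains, ideal functions, critical ideals,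
the constructible topology on the maximal spectrum.
-/

open scoped Classical Topology

namespace ADPaper

/-- Divisibility by `c` may be tested after multiplying by elements outside each maximal ideal. -/
theorem dvd_of_forall_isMaximal {R : Type*} [CommRing R] {a c : R}
    (h : ∀ M : Ideal R, M.IsMaximal → ∃ r ∉ M, c ∣ r * a) : c ∣ a := by
  let I : Ideal R := Submodule.comap (LinearMap.toSpanSingleton R R a) (Ideal.span {c})
  have mem_I (r : R) : r ∈ I ↔ c ∣ r * a := by
    simp [I, Submodule.mem_comap, Ideal.mem_span_singleton]
  have hI : I = ⊤ := by
    by_contra hI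
    obtain ⟨M, hM, hIM⟩ := Ideal.exists_le_maximal I hI
    obtain ⟨r, hr, hd⟩ := h M hM
    exact hr (hIM ((mem_I r).2 hd))
  simpa using (mem_I 1).1 (hI ▸ Submodule.mem_top)

/-- Divisibility in the localization at a prime ideal, lifted to the ring. -/
theorem exists_notMem_dvd_mul_of_algebraMap_dvd {R : Type*} [CommRing R] [IsDomain R]
    (P : Ideal R) [P.IsPrime] {a b : R}
    (h : algebraMap R (Localization.AtPrime P) a ∣ algebraMap R (Localization.AtPrime P) b) :
    ∃ r ∉ P, a ∣ r * b := by
  obtain ⟨z, hz⟩ := h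
  obtain ⟨⟨x, m⟩, hx⟩ := IsLocalization.surj P.primeCompl z
  refine ⟨m, m.2, x, ?_⟩
  apply IsLocalization.injective (Localization.AtPrime P) P.primeCompl_le_nonZeroDivisors
  simp only [map_mul] at hx ⊢
  rw [hz, ← hx]
  ring

/-- Any two elements of an almost Dedekind domain can be compared up to a partition of unity. -/
theorem AlmostDedekind.exists_dvd_mul_and_dvd_one_sub_mul {R : Type*} [CommRing R] [IsDomain R]
    (hAD : AlmostDedekind R) (a b : R) : ∃ s : R, b ∣ s * a ∧ a ∣ (1 - s) * b := by
  let I (x y : R) : Ideal R := Submodule.comap (LinearMap.toSpanSingleton R R y) (Ideal.span {x})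
  have mem_I (x y r : R) : r ∈ I x y ↔ x ∣ r * y := by
    simp [I, Submodule.mem_comap, Ideal.mem_span_singleton]
  have hI : I b a ⊔ I a b = ⊤ := by
    by_contra hI
    obtain ⟨M, hM, hIM⟩ := Ideal.exists_le_maximal _ hI
    have := hAD ⟨M, hM⟩
    change IsDiscreteValuationRing (Localization.AtPrime M) at this
    rcases ValuationRing.dvd_total (algebraMap R (Localization.AtPrime M) a)
      (algebraMap R (Localization.AtPrime M) b) with h | h
    · obtain ⟨r, hr, hd⟩ := exists_notMem_dvd_mul_of_algebraMap_dvd M h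
      exact hr (hIM (Ideal.mem_sup_right ((mem_I _ _ _).2 hd)))
    · obtain ⟨r, hr, hd⟩ := exists_notMem_dvd_mul_of_algebraMap_dvd M h
      exact hr (hIM (Ideal.mem_sup_left ((mem_I _ _ _).2 hd)))
  obtain ⟨s, hs, t, ht, hst⟩ := Submodule.mem_sup.1 (hI ▸ Submodule.mem_top : (1 : R) ∈ _)
  refine ⟨s, (mem_I _ _ _).1 hs, ?_⟩
  rw [← hst, add_sub_cancel_left]
  exact (mem_I _ _ _).1 ht

theorem AlmostDedekind.dimensionLEOne {R : Type*} [CommRing R] [IsDomain R]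
    (hAD : AlmostDedekind R) : Ring.DimensionLEOne R where
  maximalOfPrime {P} hP hPp := by
    obtain ⟨M, hM, hPM⟩ := Ideal.exists_le_maximal P hPp.ne_top
    have := hAD ⟨M, hM⟩
    change IsDiscreteValuationRing (Localization.AtPrime M) at this
    have hdisj : Disjoint (M.primeCompl : Set R) (P : Set R) :=
      Set.disjoint_left.2 fun x hx hxP => hx (hPM hxP)
    have hprime := IsLocalization.isPrime_of_isPrime_disjoint M.primeCompl
      (Localization.AtPrime M) P hPp hdisj
    have hne : P.map (algebraMap R (Localization.AtPrime M)) ≠ ⊥ := by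
      rwa [Ne, Ideal.map_eq_bot_iff_of_injective
        (IsLocalization.injective _ M.primeCompl_le_nonZeroDivisors)]
    have hmax := IsLocalRing.eq_maximalIdeal (hprime.isMaximal hne)
    have hcomap := IsLocalization.under_map_of_isPrime_disjoint M.primeCompl
      (Localization.AtPrime M) hPp hdisj
    rw [hmax, Localization.AtPrime.under_maximalIdeal] at hcomap
    exact hcomap ▸ hM

/-- In a domain of dimension at most one with nonzero Jacobson radical, every element is
von Neumann regular modulo the Jacobson radical. -/
theorem exists_forall_mem_or_one_sub_mul_mem {R : Type*} [CommRing R] [IsDomain R]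
    [Ring.DimensionLEOne R] (hJ : Ideal.jacobson (⊥ : Ideal R) ≠ ⊥) (v : R) :
    ∃ y : R, ∀ M : Ideal R, M.IsMaximal → v ∈ M ∨ 1 - v * y ∈ M := by
  let S : Submonoid R :=
    { carrier := {r | ∃ (n : ℕ) (y : R), r = v ^ n * (1 - v * y)}
      one_mem' := ⟨0, 0, by simp⟩
      mul_mem' := by
        rintro _ _ ⟨n, y, rfl⟩ ⟨m, z, rfl⟩
        exact ⟨n + m, y + z - v * y * z, by ring⟩ }
  by_cases hdisj : Disjoint (Ideal.jacobson (⊥ : Ideal R) : Set R) (S : Set R)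
  · obtain ⟨P, hP, hJP, hPS⟩ := Ideal.exists_le_prime_disjoint _ S hdisj
    have hPmax : P.IsMaximal := hP.isMaximal fun h => hJ (le_bot_iff.1 (h ▸ hJP))
    have hv : v ∉ P := fun h => Set.disjoint_left.1 hPS h ⟨1, 0, by simp⟩
    obtain ⟨y, i, hi, hy⟩ := hPmax.exists_inv hv
    refine absurd ?_ (Set.disjoint_left.1 hPS hi)
    exact ⟨0, y, by rw [← hy]; ring⟩
  · obtain ⟨_, hx, n, y, rfl⟩ := Set.not_disjoint_iff.1 hdisj
    refine ⟨y, fun M hM => ?_⟩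
    have hxM : v ^ n * (1 - v * y) ∈ M := (Submodule.mem_sInf.1 hx) M ⟨bot_le, hM⟩
    exact (hM.isPrime.mem_or_mem hxM).imp_left (hM.isPrime.mem_of_pow_mem n)

/-- An almost Dedekind domain with nonzero Jacobson radical is Bézout. -/
theorem AlmostDedekind.isBezout {R : Type*} [CommRing R] [IsDomain R]
    (hAD : AlmostDedekind R) (hJ : Ideal.jacobson (⊥ : Ideal R) ≠ ⊥) : IsBezout R := by
  have := hAD.dimensionLEOne
  rw [IsBezout.iff_span_pair_isPrincipal]
  intro a b
  obtain ⟨s, ⟨v, hv⟩, ⟨w, hw⟩⟩ := hAD.exists_dvd_mul_and_dvd_one_sub_mul a b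
  obtain ⟨y, hy⟩ := exists_forall_mem_or_one_sub_mul_mem hJ v
  let t := s * (1 - v * y)
  have key (M : Ideal R) (hM : M.IsMaximal) :
      ∃ r ∉ M, a + t * b ∣ r * a ∧ a + t * b ∣ r * b := by
    have hMp := hM.isPrime
    by_cases hvts : v + t * s ∈ M
    · have hvM : v ∈ M := by
        refine (hy M hM).elim id fun h => ?_
        have : t * s ∈ M := M.mul_mem_right _ (M.mul_mem_left _ h)
        exact (M.add_mem_iff_left this).1 hvts
      have hsM : s ∈ M := by
        have hts : s * s * (1 - v * y) ∈ M := by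
          have := (M.add_mem_iff_right hvM).1 hvts
          convert this using 1
          ring
        rcases hMp.mem_or_mem hts with h | h
        · exact (hMp.mem_or_mem h).elim id id
        · refine absurd ?_ ((Ideal.ne_top_iff_one M).1 hM.ne_top)
          simpa using M.add_mem h (M.mul_mem_right y hvM)
      refine ⟨1 - s + t * w, fun h => ?_, ⟨1 - s, ?_⟩, ⟨w, ?_⟩⟩
      · have htM : s - t * w ∈ M :=
          M.sub_mem hsM (M.mul_mem_right _ (M.mul_mem_right _ hsM))
        refine (Ideal.ne_top_iff_one M).1 hM.ne_top ?_
        convert M.add_mem h htM using 1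
        ring
      · linear_combination -t * hw
      · linear_combination hw
    · refine ⟨v + t * s, hvts, ⟨v, ?_⟩, ⟨s, ?_⟩⟩
      · linear_combination t * hv
      · linear_combination -hv
  have ha : a + t * b ∣ a := dvd_of_forall_isMaximal fun M hM =>
    let ⟨r, hr, h, _⟩ := key M hM
    ⟨r, hr, h⟩
  have hb : a + t * b ∣ b := dvd_of_forall_isMaximal fun M hM =>
    let ⟨r, hr, _, h⟩ := key M hM
    ⟨r, hr, h⟩
  refine ⟨a + t * b, le_antisymm ?_ ?_⟩
  · rw [Ideal.span_le]
    rintro x (rfl | rfl)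
    · exact Ideal.mem_span_singleton.2 ha
    · exact Ideal.mem_span_singleton.2 hb
  · rw [Ideal.submodule_span_eq, Ideal.span_singleton_le_iff_mem]
    exact Ideal.mem_span_pair.2 ⟨1, t, by ring⟩

/-- An atomic Bézout domain is a principal ideal ring. -/
theorem isPrincipalIdealRing_of_isBezout_of_atomic {R : Type*} [CommRing R] [IsDomain R]
    [IsBezout R] (hatomic : ∀ a : R, a ≠ 0 → ¬ IsUnit a →
      ∃ s : Multiset R, (∀ b ∈ s, Irreducible b) ∧ s.prod = a) :
    IsPrincipalIdealRing R := by
  have : UniqueFactorizationMonoid R := by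
    refine UniqueFactorizationMonoid.of_exists_prime_factors fun a ha => ?_
    by_cases hu : IsUnit a
    · exact ⟨0, by simp, by simpa using (associated_one_iff_isUnit.2 hu).symm⟩
    · obtain ⟨s, hs, rfl⟩ := hatomic a ha hu
      have := IsBezout.toGCDDomain R
      exact ⟨s, fun b hb => (hs b hb).prime, Associated.refl _⟩
  exact ((IsBezout.TFAE (R := R)).out 1 2).2 this

/-- Let `D` be an almost Dedekind domain that is not a Dedekind domain.
If `D` is atomic (every nonzero nonunit is a finite product of irreducibles), then the
Jacobson radical of `D` is zero. -/
theorem statement15 (R : Type*) [CommRing R] [IsDomain R] (hAD : AlmostDedekind R)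
    (hND : ¬ IsDedekindDomain R)
    (hatomic : ∀ a : R, a ≠ 0 → ¬ IsUnit a →
      ∃ s : Multiset R, (∀ b ∈ s, Irreducible b) ∧ s.prod = a) :
    Ideal.jacobson (⊥ : Ideal R) = ⊥ := by
  by_contra hJ
  have := hAD.isBezout hJ
  have := isPrincipalIdealRing_of_isBezout_of_atomic hatomic
  exact hND inferInstance

end ADPaper
end
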